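/- For Re(c) > 0, Re(s) > 0, and Re(2c - a - b) > -1, ∫₀^∞ e^{-st} t^{c-1} ₂F₂(a, b; (a+b+1)/2, 2c; st) dt = s^{-c} Γ(1/2) Γ(c) Γ(c+1/2) Γ((a+b+1)/2) Γ(c - (a+b)/2 + 1/2) / (Γ((a+1)/2) Γ((b+1)/2) Γ(c - a/2 + 1/2) Γ(c - b/2 + 1/2)). -/

import Mathlib

open Complex Set MeasureTheory

/-- Pochhammer symbol `(a)_n` on the complex numbers. -/
noncomputable def poch (a : ℂ) (n : ℕ) : ℂ := (ascPochhammer ℂ n).eval a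

/-- Generalized hypergeometric series with numerator parameters `as` and
denominator parameters `bs`, evaluated at `z`. -/
noncomputable def hyp (as bs : List ℂ) (z : ℂ) : ℂ :=
  ∑' n : ℕ, ((as.map fun a => poch a n).prod /
    ((bs.map fun b => poch b n).prod * (n.factorial : ℂ))) * z ^ n

open Filter Topology Asymptotics

/-! ### Pochhammer symbols -/

@[simp] lemma poch_zero (a : ℂ) : poch a 0 = 1 := by simp [poch]

lemma poch_succ (a : ℂ) (n : ℕ) : poch a (n + 1) = poch a n * (a + n) :=
  ascPochhammer_succ_eval n a

lemma poch_succ_left (a : ℂ) (n : ℕ) : poch a (n + 1) = a * poch (a + 1) n := by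
  simp [poch, ascPochhammer_succ_left, Polynomial.eval_comp]

lemma poch_add (a : ℂ) (m n : ℕ) : poch a (m + n) = poch a m * poch (a + m) n := by
  induction n with
  | zero => simp
  | succ n ih => rw [← add_assoc, poch_succ, ih, poch_succ]; push_cast; ring

lemma poch_eq_prod (a : ℂ) (n : ℕ) : poch a n = ∏ j ∈ Finset.range n, (a + j) := by
  induction n with
  | zero => simp
  | succ n ih => rw [poch_succ, ih, Finset.prod_range_succ]

/-- `d` is not a nonpositive integer, so that it is allowed as a denominator parameter. -/
def IsDenom (d : ℂ) : Prop := ∀ n : ℕ, d ≠ -(n : ℂ)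

lemma IsDenom.add_nat_ne_zero {d : ℂ} (h : IsDenom d) (n : ℕ) : d + n ≠ 0 :=
  fun h0 => h n (eq_neg_of_add_eq_zero_left h0)

lemma IsDenom.ne_zero {d : ℂ} (h : IsDenom d) : d ≠ 0 := by simpa using h.add_nat_ne_zero 0

lemma IsDenom.add_nat {d : ℂ} (h : IsDenom d) (m : ℕ) : IsDenom (d + m) := fun n h0 =>
  h (m + n) (by push_cast; linear_combination h0)

lemma IsDenom.add_one {d : ℂ} (h : IsDenom d) : IsDenom (d + 1) := by
  simpa using h.add_nat 1

lemma IsDenom.add_two {d : ℂ} (h : IsDenom d) : IsDenom (d + 2) := by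
  simpa using h.add_nat 2

lemma isDenom_of_re_pos {d : ℂ} (h : 0 < d.re) : IsDenom d := by
  rintro n rfl
  simp only [neg_re, natCast_re, Left.neg_pos_iff] at h
  exact absurd h (not_lt.2 n.cast_nonneg)

lemma IsDenom.poch_ne_zero {d : ℂ} (h : IsDenom d) (n : ℕ) : poch d n ≠ 0 := by
  rw [poch_eq_prod]
  exact Finset.prod_ne_zero_iff.2 fun j _ => h.add_nat_ne_zero j

lemma IsDenom.Gamma_ne_zero {d : ℂ} (h : IsDenom d) : Gamma d ≠ 0 :=
  Complex.Gamma_ne_zero h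

lemma Gamma_add_nat_eq_poch {c : ℂ} (hc : IsDenom c) (n : ℕ) :
    Gamma (c + n) = poch c n * Gamma c := by
  induction n with
  | zero => simp
  | succ n ih =>
    rw [Nat.cast_succ, ← add_assoc, Gamma_add_one _ (hc.add_nat_ne_zero n), ih, poch_succ]
    ring

lemma norm_poch_re_le {c : ℂ} (hc : 0 < c.re) (n : ℕ) : ‖poch (c.re : ℂ) n‖ ≤ ‖poch c n‖ := by
  rw [poch_eq_prod, poch_eq_prod, norm_prod, norm_prod]
  refine Finset.prod_le_prod (fun _ _ => norm_nonneg _) fun j _ => ?_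
  have h1 : (c.re : ℂ) + j = ((c.re + j : ℝ) : ℂ) := by push_cast; rfl
  rw [h1, norm_real, Real.norm_of_nonneg (by positivity)]
  simpa using re_le_norm (c + j)

lemma norm_poch_mono {x y : ℝ} (hx : 0 < x) (hxy : x ≤ y) (n : ℕ) :
    ‖poch (x : ℂ) n‖ ≤ ‖poch (y : ℂ) n‖ := by
  have hy : 0 < y := hx.trans_le hxy
  rw [poch_eq_prod, poch_eq_prod, norm_prod, norm_prod]
  refine Finset.prod_le_prod (fun _ _ => norm_nonneg _) fun j _ => ?_
  rw [← ofReal_natCast, ← ofReal_add, ← ofReal_add, norm_real, norm_real,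
    Real.norm_of_nonneg (by positivity), Real.norm_of_nonneg (by positivity)]
  linarith

lemma tendsto_poch_div (a : ℂ) :
    Tendsto (fun n : ℕ => poch a (n + 1) / (n.factorial * (n : ℂ) ^ a)) atTop
      (𝓝 (Gamma a)⁻¹) := by
  by_cases ha : IsDenom a
  · refine ((GammaSeq_tendsto_Gamma a).inv₀ ha.Gamma_ne_zero).congr fun n => ?_
    rw [GammaSeq, poch_eq_prod, inv_div, mul_comm ((n : ℂ) ^ a)]
  · obtain ⟨m, rfl⟩ : ∃ m : ℕ, a = -(m : ℂ) := by simpa [IsDenom] using ha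
    rw [Complex.Gamma_neg_nat_eq_zero, inv_zero]
    refine tendsto_const_nhds.congr' ?_
    filter_upwards [eventually_ge_atTop m] with n hn
    rw [poch_eq_prod, Finset.prod_eq_zero (Finset.mem_range.2 (Nat.lt_succ_of_le hn)) (by simp),
      zero_div]

lemma poch_succ_isBigO (a : ℂ) :
    (fun n : ℕ => poch a (n + 1) / n.factorial) =O[atTop] fun n : ℕ => (n : ℝ) ^ a.re := by
  have h := (tendsto_poch_div a).isBigO_one ℝ
  have h2 : (fun n : ℕ => (n : ℂ) ^ a) =O[atTop] fun n : ℕ => (n : ℝ) ^ a.re := by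
    refine IsBigO.of_bound 1 ?_
    filter_upwards [eventually_gt_atTop 0] with n hn
    rw [norm_natCast_cpow_of_pos hn, one_mul]
    exact le_abs_self _
  refine (h.mul h2).congr' ?_ (by simp)
  filter_upwards [eventually_gt_atTop 0] with n hn
  have : (n : ℂ) ^ a ≠ 0 := by simp [cpow_eq_zero_iff, hn.ne']
  field_simp

lemma inv_poch_succ_isBigO {d : ℂ} (hd : IsDenom d) :
    (fun n : ℕ => (n.factorial : ℂ) / poch d (n + 1)) =O[atTop]
      fun n : ℕ => (n : ℝ) ^ (-d.re) := by
  have h := ((tendsto_poch_div d).inv₀ (inv_ne_zero hd.Gamma_ne_zero)).isBigO_one ℝ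
  have h2 : (fun n : ℕ => (n : ℂ) ^ (-d)) =O[atTop] fun n : ℕ => (n : ℝ) ^ (-d.re) := by
    refine IsBigO.of_bound 1 ?_
    filter_upwards [eventually_gt_atTop 0] with n hn
    rw [norm_natCast_cpow_of_pos hn, one_mul]
    exact le_abs_self _
  refine (h.mul h2).congr' ?_ (by simp)
  filter_upwards [eventually_gt_atTop 0] with n hn
  have : (n : ℂ) ^ d ≠ 0 := by simp [cpow_eq_zero_iff, hn.ne']
  rw [cpow_neg, inv_div]
  field_simp

lemma inv_natCast_succ_isBigO :
    (fun n : ℕ => ((n : ℂ) + 1)⁻¹) =O[atTop] fun n : ℕ => (n : ℝ) ^ (-1 : ℝ) := by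
  refine IsBigO.of_bound 1 ?_
  filter_upwards [eventually_gt_atTop 0] with n hn
  have hn' : (0 : ℝ) < n := by exact_mod_cast hn
  rw [Real.rpow_neg_one, norm_inv, norm_inv, one_mul, ← Nat.cast_succ, norm_natCast,
    Real.norm_of_nonneg hn'.le]
  gcongr
  simp

/-- Terms of the Gauss series `₂F₁(a, b; d; 1)`. -/
noncomputable def gaussTerm (a b d : ℂ) (n : ℕ) : ℂ :=
  poch a n * poch b n / (poch d n * n.factorial)

lemma gaussTerm_succ_isBigO (a b : ℂ) {d : ℂ} (hd : IsDenom d) :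
    (fun n : ℕ => gaussTerm a b d (n + 1)) =O[atTop]
      fun n : ℕ => (n : ℝ) ^ ((a + b - d).re - 1) := by
  refine ((((poch_succ_isBigO a).mul (poch_succ_isBigO b)).mul (inv_poch_succ_isBigO hd)).mul
    inv_natCast_succ_isBigO).congr' ?_ ?_
  · refine Eventually.of_forall fun n => ?_
    have := hd.poch_ne_zero (n + 1)
    have h2 : (n : ℂ) + 1 ≠ 0 := Nat.cast_add_one_ne_zero n
    simp only [gaussTerm, Nat.factorial_succ]
    push_cast
    field_simp
  · filter_upwards [eventually_gt_atTop 0] with n hn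
    have hn' : (0 : ℝ) < n := by exact_mod_cast hn
    rw [← Real.rpow_add hn', ← Real.rpow_add hn', ← Real.rpow_add hn']
    simp only [add_re, sub_re]
    ring_nf

lemma summable_norm_gaussTerm {a b d : ℂ} (hd : IsDenom d) (h : 0 < (d - a - b).re) :
    Summable fun n => ‖gaussTerm a b d n‖ := by
  rw [← summable_nat_add_iff 1]
  refine summable_of_isBigO_nat ?_ (gaussTerm_succ_isBigO a b hd).norm_left
  refine Real.summable_nat_rpow.2 ?_
  simp only [add_re, sub_re] at h ⊢
  linarith

lemma gaussTerm_ratio (a b : ℂ) {d : ℂ} (hd : IsDenom d) (n : ℕ) :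
    (d + n) * (n + 1) * gaussTerm a b d (n + 1) = (a + n) * (b + n) * gaussTerm a b d n := by
  have h1 := hd.poch_ne_zero n
  have h2 := hd.add_nat_ne_zero n
  have h3 : (n : ℂ) + 1 ≠ 0 := Nat.cast_add_one_ne_zero n
  simp only [gaussTerm, Nat.factorial_succ, poch_succ]
  push_cast
  field_simp

lemma tsum_eq_zero_of_telescoping {u v : ℕ → ℂ} (hu : Summable u)
    (huv : ∀ n, u n = v (n + 1) - v n) (hv0 : v 0 = 0) (hv : Tendsto v atTop (𝓝 0)) :
    ∑' n, u n = 0 := by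
  refine tendsto_nhds_unique hu.hasSum.tendsto_sum_nat (hv.congr fun n => ?_)
  rw [Finset.sum_congr rfl fun k _ => huv k, Finset.sum_range_sub, hv0, sub_zero]

lemma tendsto_nat_mul_gaussTerm {a b d : ℂ} (hd : IsDenom d) (h : 0 < (d - a - b).re) :
    Tendsto (fun n : ℕ => (n : ℂ) * gaussTerm a b d n) atTop (𝓝 0) := by
  rw [← tendsto_add_atTop_iff_nat 1]
  have h1 : (fun n : ℕ => ((n + 1 : ℕ) : ℂ)) =O[atTop] fun n : ℕ => (n : ℝ) := by
    refine IsBigO.of_bound 2 ?_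
    filter_upwards [eventually_ge_atTop 1] with n hn
    have hn' : (1 : ℝ) ≤ n := by exact_mod_cast hn
    rw [norm_natCast, Real.norm_of_nonneg (by positivity)]
    push_cast
    linarith
  refine (h1.mul (gaussTerm_succ_isBigO a b hd)).trans_tendsto ?_
  have h2 : Tendsto (fun n : ℕ => (n : ℝ) ^ (-(d - a - b).re)) atTop (𝓝 0) :=
    (tendsto_rpow_neg_atTop h).comp tendsto_natCast_atTop_atTop
  refine h2.congr' ?_
  filter_upwards [eventually_gt_atTop 0] with n hn
  have hn' : (0 : ℝ) < n := by exact_mod_cast hn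
  conv_rhs => rw [← Real.rpow_one (n : ℝ)]
  rw [Real.rpow_one, ← Real.rpow_one_add' hn'.le]
  · congr 1
    simp only [add_re, sub_re]
    ring
  · simp only [add_re, sub_re] at h ⊢
    linarith

lemma gaussTerm_add_one (a b : ℂ) {d : ℂ} (hd : IsDenom d) (n : ℕ) :
    (d + n) * gaussTerm a b (d + 1) n = d * gaussTerm a b d n := by
  have h1 := hd.poch_ne_zero n
  have h2 := hd.add_one.poch_ne_zero n
  have h3 : d * poch (d + 1) n = poch d n * (d + n) := by rw [← poch_succ_left, poch_succ]
  have h4 : (n.factorial : ℂ) ≠ 0 := Nat.cast_ne_zero.2 n.factorial_ne_zero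
  simp only [gaussTerm]
  field_simp
  linear_combination -(poch a n * poch b n) * h3

lemma gauss_contiguous {a b d : ℂ} (hd : IsDenom d) (h : 0 < (d - a - b).re) :
    d * (d - a - b) * ∑' n, gaussTerm a b d n =
      (d - a) * (d - b) * ∑' n, gaussTerm a b (d + 1) n := by
  have h' : 0 < (d + 1 - a - b).re := by
    simp only [add_re, sub_re, one_re] at h ⊢
    linarith
  have s1 := ((summable_norm_gaussTerm hd h).of_norm).mul_left (d * (d - a - b))
  have s2 := ((summable_norm_gaussTerm hd.add_one h').of_norm).mul_left ((d - a) * (d - b))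
  rw [← sub_eq_zero, ← tsum_mul_left, ← tsum_mul_left, ← s1.tsum_sub s2]
  refine tsum_eq_zero_of_telescoping (v := fun n => -d * (n * gaussTerm a b d n)) (s1.sub s2)
    (fun n => ?_) (by simp) (by simpa using (tendsto_nat_mul_gaussTerm hd h).const_mul (-d))
  have e1 := gaussTerm_ratio a b hd n
  have e2 := gaussTerm_add_one a b hd n
  have h2 := hd.add_nat_ne_zero n
  refine mul_left_cancel₀ h2 ?_
  push_cast
  linear_combination d * e1 - (d - a) * (d - b) * e2

lemma gauss_iterate {a b d : ℂ} (hd : IsDenom d) (h : 0 < (d - a - b).re) (m : ℕ) :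
    poch d m * poch (d - a - b) m * ∑' n, gaussTerm a b d n =
      poch (d - a) m * poch (d - b) m * ∑' n, gaussTerm a b (d + m) n := by
  induction m with
  | zero => simp
  | succ m ih =>
    have h' : 0 < (d + m - a - b).re := by
      simp only [add_re, sub_re, natCast_re] at h ⊢
      have : (0 : ℝ) ≤ m := m.cast_nonneg
      linarith
    have e := gauss_contiguous (hd.add_nat m) h'
    simp only [poch_succ]
    push_cast
    rw [← add_assoc]
    linear_combination (d + m) * (d - a - b + m) * ih + poch (d - a) m * poch (d - b) m * e

lemma tendsto_tsum_gaussTerm {a b d : ℂ} :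
    Tendsto (fun m : ℕ => ∑' n, gaussTerm a b (d + m) n) atTop (𝓝 1) := by
  obtain ⟨k, hk⟩ := exists_nat_gt (max (-d.re) ((a + b).re - d.re))
  have hk1 := (le_max_left _ _).trans_lt hk
  have hk2 := (le_max_right _ _).trans_lt hk
  set x : ℝ := d.re + k with hx
  have hx0 : 0 < x := by linarith
  have hxd : IsDenom (x : ℂ) := isDenom_of_re_pos (by simpa using hx0)
  have hs := summable_norm_gaussTerm (a := a) (b := b) hxd (by
    simp only [add_re, sub_re, ofReal_re] at hk2 ⊢
    linarith)
  have hone : ∑' n : ℕ, (if n = 0 then (1 : ℂ) else 0) = 1 := tsum_ite_eq 0 _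
  rw [← hone]
  refine tendsto_tsum_of_dominated_convergence hs (fun n => ?_) ?_
  · rcases n with _ | n
    · simp [gaussTerm]
    · simp only [Nat.add_eq_zero_iff, one_ne_zero, and_false, if_false]
      have hden : Tendsto (fun m : ℕ => ‖poch (d + m) (n + 1) * ((n + 1).factorial : ℂ)‖)
          atTop atTop := by
        have hN : Tendsto (fun m : ℕ => ‖d + (m : ℂ)‖) atTop atTop := by
          refine tendsto_atTop_mono (fun m => ?_) (tendsto_atTop_add_const_left _ d.re
            (tendsto_natCast_atTop_atTop (R := ℝ)))
          simpa using re_le_norm (d + m)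
        refine tendsto_atTop_mono' _ ?_ hN
        filter_upwards [eventually_ge_atTop (k + 1)] with m hm
        have hm' : (k : ℝ) + 1 ≤ m := by exact_mod_cast hm
        rw [poch_succ_left, norm_mul, norm_mul, norm_natCast, mul_assoc]
        refine le_mul_of_one_le_right (norm_nonneg _) ?_
        have hf : (1 : ℝ) ≤ (n + 1).factorial := by exact_mod_cast (n + 1).factorial_pos
        refine one_le_mul_of_one_le_of_one_le ?_ hf
        rw [poch_eq_prod, norm_prod]
        refine Finset.prod_induction _ (fun x : ℝ => 1 ≤ x)
          (fun _ _ => one_le_mul_of_one_le_of_one_le) le_rfl fun j _ => ?_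
        refine le_trans ?_ (re_le_norm _)
        simp only [add_re, natCast_re, one_re]
        have : (0 : ℝ) ≤ j := j.cast_nonneg
        linarith
      rw [tendsto_zero_iff_norm_tendsto_zero]
      simp only [gaussTerm, norm_div]
      exact hden.const_div_atTop _
  · filter_upwards [eventually_ge_atTop k] with m hm n
    have hm' : (k : ℝ) ≤ m := by exact_mod_cast hm
    have hre : (d + m).re = d.re + m := by simp
    have h1 : ‖poch (x : ℂ) n‖ ≤ ‖poch (d + m) n‖ :=
      (norm_poch_mono hx0 (by rw [hre]; linarith) n).trans
        (norm_poch_re_le (by rw [hre]; linarith) n)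
    simp only [gaussTerm, norm_div, norm_mul]
    have := norm_pos_iff.2 (hxd.poch_ne_zero n)
    have hf := norm_pos_iff.2 (Nat.cast_ne_zero (R := ℂ).2 n.factorial_ne_zero)
    gcongr

/-- Gauss's summation theorem. -/
theorem tsum_gaussTerm {a b d : ℂ} (hd : IsDenom d) (h : 0 < (d - a - b).re) :
    ∑' n, gaussTerm a b d n =
      Gamma d * Gamma (d - a - b) / (Gamma (d - a) * Gamma (d - b)) := by
  have hd' : IsDenom (d - a - b) := isDenom_of_re_pos h
  have g1 := hd.Gamma_ne_zero
  have g2 := hd'.Gamma_ne_zero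
  have hL := ((tendsto_poch_div d).mul (tendsto_poch_div (d - a - b))).mul_const
    (∑' n, gaussTerm a b d n)
  have hR := ((tendsto_poch_div (d - a)).mul (tendsto_poch_div (d - b))).mul
    ((tendsto_tsum_gaussTerm (a := a) (b := b) (d := d)).comp (tendsto_add_atTop_nat 1))
  have key := tendsto_nhds_unique hL (hR.congr' ?_)
  · have h3 : ∑' n, gaussTerm a b d n = Gamma d * Gamma (d - a - b) *
        ((Gamma d)⁻¹ * (Gamma (d - a - b))⁻¹ * ∑' n, gaussTerm a b d n) := by
      field_simp
    rw [h3, key, mul_one, div_eq_mul_inv, mul_inv]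
  · filter_upwards [eventually_gt_atTop 0] with n hn
    have hn0 : (n : ℂ) ≠ 0 := Nat.cast_ne_zero.2 hn.ne'
    have e := gauss_iterate hd h (n + 1)
    have p1 : (n : ℂ) ^ (d - a) * (n : ℂ) ^ (d - b) = (n : ℂ) ^ d * (n : ℂ) ^ (d - a - b) := by
      rw [← cpow_add _ _ hn0, ← cpow_add _ _ hn0]
      ring_nf
    simp only [Function.comp_apply]
    rw [div_mul_div_comm, div_mul_div_comm, mul_mul_mul_comm, p1, div_mul_eq_mul_div, ← e,
      ← mul_div_right_comm, mul_mul_mul_comm (n.factorial : ℂ)]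

/-! ### Moments of the symmetric beta distribution -/

/-- The moments `(1/2)_k / (c + 1/2)_k`, `j = 2 * k`, of the density proportional to
`(1 - y ^ 2) ^ (c - 1)` on `(-1, 1)`. -/
noncomputable def symmMoment (c : ℂ) : ℕ → ℂ
  | 0 => 1
  | 1 => 0
  | (j + 2) => (j + 1) / (2 * c + 1 + j) * symmMoment c j

lemma sum_choose_succ_mul (f : ℕ → ℂ) (n : ℕ) :
    ∑ j ∈ Finset.range (n + 2), ((n + 1).choose j : ℂ) * f j =
      ∑ j ∈ Finset.range (n + 1), (n.choose j : ℂ) * f j +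
        ∑ j ∈ Finset.range (n + 1), (n.choose j : ℂ) * f (j + 1) := by
  have h : ∑ j ∈ Finset.range (n + 1), (n.choose j : ℂ) * f j =
      ∑ j ∈ Finset.range (n + 2), (n.choose j : ℂ) * f j := by
    rw [Finset.sum_range_succ _ (n + 1)]
    simp
  rw [h, Finset.sum_range_succ', Finset.sum_range_succ' _ (n + 1), add_right_comm,
    ← Finset.sum_add_distrib]
  simp only [Nat.choose_succ_succ', Nat.choose_zero_right]
  congr 1
  refine Finset.sum_congr rfl fun j _ => ?_
  push_cast
  ring

lemma sum_choose_succ_mul_of_eq {w g : ℕ → ℂ} (h0 : w 0 = 0)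
    (hw : ∀ j : ℕ, w (j + 1) = (j + 1) * g j) (n : ℕ) :
    ∑ j ∈ Finset.range (n + 2), ((n + 1).choose j : ℂ) * w j =
      (n + 1) * ∑ j ∈ Finset.range (n + 1), (n.choose j : ℂ) * g j := by
  rw [Finset.sum_range_succ', h0, mul_zero, add_zero, Finset.mul_sum]
  refine Finset.sum_congr rfl fun j _ => ?_
  have h := congrArg (Nat.cast (R := ℂ)) (Nat.add_one_mul_choose_eq n j)
  push_cast at h
  rw [hw]
  linear_combination -g j * h

lemma symmMoment_add_two {c : ℂ} (hc : IsDenom (2 * c)) (j : ℕ) :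
    (2 * c + 1 + j) * symmMoment c (j + 2) = (j + 1) * symmMoment c j := by
  have := hc.add_one.add_nat_ne_zero j
  rw [symmMoment]
  field_simp

lemma sum_choose_mul_symmMoment_succ {c : ℂ} (hc : IsDenom (2 * c)) (n : ℕ) :
    (2 * c + n) * ∑ j ∈ Finset.range (n + 1), (n.choose j : ℂ) * symmMoment c (j + 1) =
      n * ∑ j ∈ Finset.range (n + 1), (n.choose j : ℂ) * symmMoment c j := by
  rcases n with _ | n
  · simp [symmMoment]
  have h1 := sum_choose_succ_mul_of_eq (w := fun j => (2 * c + j) * symmMoment c (j + 1))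
    (g := symmMoment c) (by simp [symmMoment]) (fun j => by
      have := symmMoment_add_two hc j
      push_cast
      linear_combination this) n
  have h2 := sum_choose_succ_mul_of_eq (w := fun j => j * symmMoment c (j + 1))
    (g := fun j => symmMoment c (j + 2)) (by simp) (fun j => by push_cast; ring) n
  have h3 := sum_choose_succ_mul (symmMoment c) n
  have h4 := sum_choose_succ_mul (fun j => symmMoment c (j + 1)) n
  have h5 : ∑ j ∈ Finset.range (n + 2), ((n + 1).choose j : ℂ) *
      ((2 * c + j) * symmMoment c (j + 1)) =
      2 * c * ∑ j ∈ Finset.range (n + 2), ((n + 1).choose j : ℂ) * symmMoment c (j + 1) +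
      ∑ j ∈ Finset.range (n + 2), ((n + 1).choose j : ℂ) * (j * symmMoment c (j + 1)) := by
    rw [Finset.mul_sum, ← Finset.sum_add_distrib]
    exact Finset.sum_congr rfl fun j _ => by ring
  push_cast
  linear_combination h1 - h5 - h2 + (n + 1) * h4 - (n + 1) * h3

lemma sum_choose_mul_symmMoment {c : ℂ} (hc : IsDenom (2 * c)) (n : ℕ) :
    ∑ j ∈ Finset.range (n + 1), (n.choose j : ℂ) * symmMoment c j =
      2 ^ n * (poch c n / poch (2 * c) n) := by
  induction n with
  | zero => simp [symmMoment]
  | succ n ih =>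
    have h1 := sum_choose_mul_symmMoment_succ hc n
    have h2 := hc.add_nat_ne_zero n
    have h3 := hc.poch_ne_zero n
    refine mul_left_cancel₀ h2 ?_
    rw [sum_choose_succ_mul, mul_add, h1, ih, poch_succ, poch_succ]
    field_simp
    ring

lemma symmMoment_ofReal {x : ℝ} (hx : 0 < x) :
    ∀ j : ℕ, symmMoment x j = (‖symmMoment x j‖ : ℂ)
  | 0 => by simp [symmMoment]
  | 1 => by simp [symmMoment]
  | (j + 2) => by
    have h : ((j : ℂ) + 1) / (2 * x + 1 + j) = (((j + 1) / (2 * x + 1 + j) : ℝ) : ℂ) := by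
      push_cast; rfl
    rw [symmMoment, norm_mul, h, norm_real, Real.norm_of_nonneg (by positivity), ofReal_mul,
      ← symmMoment_ofReal hx j]

lemma norm_symmMoment_le {c : ℂ} (hc : 0 < c.re) :
    ∀ j : ℕ, ‖symmMoment c j‖ ≤ ‖symmMoment (c.re : ℂ) j‖
  | 0 => by simp [symmMoment]
  | 1 => by simp [symmMoment]
  | (j + 2) => by
    rw [symmMoment, symmMoment, norm_mul, norm_mul, norm_div, norm_div]
    have h : 2 * (c.re : ℂ) + 1 + j = ((2 * c.re + 1 + j : ℝ) : ℂ) := by push_cast; rfl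
    have h2 : ‖2 * (c.re : ℂ) + 1 + j‖ ≤ ‖2 * c + 1 + j‖ := by
      rw [h, norm_real, Real.norm_of_nonneg (by positivity)]
      simpa using re_le_norm (2 * c + 1 + j)
    have h3 : 0 < ‖2 * (c.re : ℂ) + 1 + j‖ := by
      rw [h, norm_real, Real.norm_of_nonneg (by positivity)]
      positivity
    have := norm_symmMoment_le hc j
    gcongr

lemma isDenom_two_mul {c : ℂ} (hc : 0 < c.re) : IsDenom (2 * c) :=
  isDenom_of_re_pos (by simpa using hc)

lemma sum_choose_mul_norm_symmMoment_le {c : ℂ} (hc : 0 < c.re) (n : ℕ) :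
    ∑ j ∈ Finset.range (n + 1), (n.choose j : ℝ) * ‖symmMoment c j‖ ≤
      2 ^ n * (‖poch (c.re : ℂ) n‖ / ‖poch (2 * (c.re : ℂ)) n‖) := by
  have hr : 0 < ((c.re : ℂ)).re := by simpa using hc
  refine (Finset.sum_le_sum fun j _ => mul_le_mul_of_nonneg_left (norm_symmMoment_le hc j)
    (Nat.cast_nonneg _)).trans (le_of_eq ?_)
  have h := sum_choose_mul_symmMoment (isDenom_two_mul hr) n
  have h2 : ((∑ j ∈ Finset.range (n + 1), (n.choose j : ℝ) * ‖symmMoment (c.re : ℂ) j‖ : ℝ) : ℂ) =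
      2 ^ n * (poch (c.re : ℂ) n / poch (2 * (c.re : ℂ)) n) := by
    rw [← h]
    push_cast
    exact Finset.sum_congr rfl fun j _ => by rw [← symmMoment_ofReal hc j]
  have h3 := congrArg norm h2
  rw [norm_real, Real.norm_of_nonneg (by positivity)] at h3
  simpa using h3

/-! ### Watson's theorem -/

lemma summable_gaussTerm_mul_poch_div {a b c d : ℂ} (hd : IsDenom d) (hc : 0 < c.re)
    (h : 0 < (d + c - a - b).re) :
    Summable fun n => ‖gaussTerm a b d n‖ *
      (‖poch (c.re : ℂ) n‖ / ‖poch (2 * (c.re : ℂ)) n‖) := by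
  have hr : 0 < ((c.re : ℂ)).re := by simpa using hc
  have h2 := isDenom_two_mul hr
  rw [← summable_nat_add_iff 1]
  have hO := ((gaussTerm_succ_isBigO a b hd).mul (poch_succ_isBigO (c.re : ℂ))).mul
    (inv_poch_succ_isBigO h2)
  have hO' : (fun n : ℕ => gaussTerm a b d (n + 1) *
      (poch (c.re : ℂ) (n + 1) / poch (2 * (c.re : ℂ)) (n + 1))) =O[atTop]
      fun n : ℕ => (n : ℝ) ^ (-(d + c - a - b).re - 1) := by
    refine hO.congr' ?_ ?_
    · refine Eventually.of_forall fun n => ?_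
      have := Nat.cast_ne_zero (R := ℂ).2 n.factorial_ne_zero
      have := h2.poch_ne_zero (n + 1)
      field_simp
    · filter_upwards [eventually_gt_atTop 0] with n hn
      have hn' : (0 : ℝ) < n := by exact_mod_cast hn
      rw [← Real.rpow_add hn', ← Real.rpow_add hn']
      simp only [add_re, sub_re, mul_re, ofReal_re, ofReal_im, re_ofNat, im_ofNat]
      ring_nf
  have := summable_of_isBigO_nat (Real.summable_nat_rpow.2 (by linarith)) hO'.norm_left
  simpa only [norm_mul, norm_div] using this

/-- The terms of `2 ^ (-j)` times the `j`-th derivative of `₂F₁(a, b; d; ·)` at `1/2`. -/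
noncomputable def halfTerm (a b d : ℂ) (j m : ℕ) : ℂ :=
  poch a (j + m) * poch b (j + m) / (poch d (j + m) * m.factorial) * (1 / 2) ^ (j + m)

lemma halfTerm_eq (a b d : ℂ) (j m : ℕ) :
    halfTerm a b d j m = j.factorial *
      (gaussTerm a b d (j + m) * (1 / 2) ^ (j + m) * (j + m).choose j) := by
  have h1 := congrArg (Nat.cast (R := ℂ)) (Nat.add_choose_mul_factorial_mul_factorial j m)
  rw [← Nat.choose_symm_add] at h1
  push_cast at h1
  have h2 : ((j + m).factorial : ℂ) ≠ 0 := Nat.cast_ne_zero.2 (Nat.factorial_ne_zero _)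
  have h3 : (m.factorial : ℂ) ≠ 0 := Nat.cast_ne_zero.2 (Nat.factorial_ne_zero _)
  simp only [halfTerm, gaussTerm, div_eq_mul_inv, mul_inv]
  field_simp
  rw [← h1]
  ring

lemma halfTerm_succ (a b d : ℂ) (j m : ℕ) :
    halfTerm a b d (j + 1) m = (m + 1) * halfTerm a b d j (m + 1) := by
  have h3 : (m.factorial : ℂ) ≠ 0 := Nat.cast_ne_zero.2 (Nat.factorial_ne_zero _)
  have h4 : (m : ℂ) + 1 ≠ 0 := Nat.cast_add_one_ne_zero m
  simp only [halfTerm, Nat.factorial_succ, show j + 1 + m = j + (m + 1) by ring,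
    div_eq_mul_inv, mul_inv]
  push_cast
  field_simp

lemma halfTerm_ratio {a b d : ℂ} (hd : IsDenom d) (j m : ℕ) :
    2 * (d + j + m) * (m + 1) * halfTerm a b d j (m + 1) =
      (a + j + m) * (b + j + m) * halfTerm a b d j m := by
  have h1 := hd.poch_ne_zero (j + m)
  have h2 := hd.add_nat_ne_zero (j + m)
  have h3 : (m.factorial : ℂ) ≠ 0 := Nat.cast_ne_zero.2 (Nat.factorial_ne_zero _)
  have h4 : (m : ℂ) + 1 ≠ 0 := Nat.cast_add_one_ne_zero m
  simp only [halfTerm, Nat.factorial_succ, ← add_assoc, poch_succ, pow_succ]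
  push_cast at h2 ⊢
  field_simp
  ring

lemma summable_halfTerm (a b : ℂ) {d : ℂ} (hd : IsDenom d) (j : ℕ) :
    Summable (halfTerm a b d j) := by
  obtain ⟨k, hk⟩ := exists_nat_gt ((a + b - d).re - 1)
  have h1 : (fun n : ℕ => gaussTerm a b d (n + 1)) =O[atTop] fun n : ℕ => (n : ℝ) ^ k := by
    refine (gaussTerm_succ_isBigO a b hd).trans (IsBigO.of_bound 1 ?_)
    filter_upwards [eventually_ge_atTop 1] with n hn
    have hn' : (1 : ℝ) ≤ n := by exact_mod_cast hn
    rw [Real.norm_of_nonneg (by positivity), Real.norm_of_nonneg (by positivity), one_mul,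
      ← Real.rpow_natCast]
    exact Real.rpow_le_rpow_of_exponent_le hn' hk.le
  have h2 : (fun n : ℕ => ((n + 1).choose j : ℂ)) =O[atTop] fun n : ℕ => (n : ℝ) ^ j := by
    refine IsBigO.of_bound (2 ^ j) ?_
    filter_upwards [eventually_ge_atTop 1] with n hn
    have hn' : (1 : ℝ) ≤ n := by exact_mod_cast hn
    rw [norm_natCast, Real.norm_of_nonneg (by positivity), ← mul_pow]
    calc ((n + 1).choose j : ℝ) ≤ ((n + 1 : ℕ) : ℝ) ^ j := by
          exact_mod_cast Nat.choose_le_pow (n + 1) j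
      _ ≤ _ := by
        push_cast
        gcongr
        linarith
  have h3 : (fun n : ℕ => ((1 : ℂ) / 2) ^ (n + 1)) =O[atTop] fun n : ℕ => ((1 : ℝ) / 2) ^ n := by
    refine IsBigO.of_bound 1 (Eventually.of_forall fun n => ?_)
    rw [norm_pow, norm_pow, one_mul]
    simpa using pow_le_pow_of_le_one (by norm_num : (0 : ℝ) ≤ 2⁻¹) (by norm_num) n.le_succ
  have h4 : Summable fun n : ℕ => (n : ℝ) ^ (k + j) * (1 / 2) ^ n :=
    summable_pow_mul_geometric_of_norm_lt_one (k + j) (by norm_num)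
  have h5 : Summable fun n : ℕ => gaussTerm a b d (n + 1) * (1 / 2) ^ (n + 1) *
      ((n + 1).choose j : ℂ) := by
    refine summable_of_isBigO_nat h4 (((h1.mul h3).mul h2).congr_right fun n => ?_)
    rw [pow_add]
    ring
  have h6 := (summable_nat_add_iff 1 (f := fun n : ℕ => gaussTerm a b d n * (1 / 2) ^ n *
      (n.choose j : ℂ))).1 h5
  have h7 := ((summable_nat_add_iff j).2 h6).mul_left (j.factorial : ℂ)
  refine h7.congr fun m => ?_
  rw [halfTerm_eq, add_comm m j]

lemma tsum_halfTerm_add_two {a b d : ℂ} (hd : IsDenom d) (hab : 2 * d = a + b + 1) (j : ℕ) :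
    ∑' m, halfTerm a b d (j + 2) m = (a + j) * (b + j) * ∑' m, halfTerm a b d j m := by
  have s0 := summable_halfTerm a b hd j
  have s1 := summable_halfTerm a b hd (j + 1)
  have s2 := summable_halfTerm a b hd (j + 2)
  have e1 := halfTerm_succ a b d j
  have e2 := halfTerm_succ a b d (j + 1)
  set f : ℕ → ℂ := fun m => m * (m - 1) * halfTerm a b d j m with hf
  have f2 : ∀ m, f (m + 2) = halfTerm a b d (j + 2) m := fun m => by
    rw [e2 m, e1 (m + 1)]
    simp only [hf]
    push_cast
    ring
  have sf : Summable f := (summable_nat_add_iff 2).1 (s2.congr fun m => (f2 m).symm)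
  have hsum : ∑' m, halfTerm a b d (j + 2) m = ∑' m, f m := by
    rw [← sf.sum_add_tsum_nat_add 2]
    simp [Finset.sum_range_succ, hf, ← f2]
  rw [hsum, ← sub_eq_zero, ← tsum_mul_left, ← sf.tsum_sub (s0.mul_left _)]
  refine tsum_eq_zero_of_telescoping
    (v := fun m => -2 * m * (d + j + m - 1) * halfTerm a b d j m) (sf.sub (s0.mul_left _))
    (fun m => ?_) (by simp) ?_
  · have := halfTerm_ratio (a := a) (b := b) hd j m
    simp only [hf]
    push_cast
    linear_combination this - m * halfTerm a b d j m * hab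
  · rw [← tendsto_add_atTop_iff_nat 2]
    have t1 := ((summable_nat_add_iff 1).2 s1).tendsto_atTop_zero.const_mul (-2 * (d + j))
    have t2 := s2.tendsto_atTop_zero.const_mul (-2)
    have t3 := t1.add t2
    rw [mul_zero, mul_zero, add_zero] at t3
    refine t3.congr fun m => ?_
    rw [e2 m, e1 (m + 1)]
    push_cast
    ring

lemma summable_of_summable_antidiagonal {f : ℕ × ℕ → ℂ} {g : ℕ → ℝ} (hg : Summable g)
    (h : ∀ n, ∑ p ∈ Finset.HasAntidiagonal.antidiagonal n, ‖f p‖ ≤ g n) : Summable f := by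
  refine Summable.of_norm ?_
  rw [← Finset.HasAntidiagonal.sigmaAntidiagonalEquivProd.summable_iff]
  refine (summable_sigma_of_nonneg fun _ => norm_nonneg _).2 ⟨fun n => Summable.of_finite, ?_⟩
  refine hg.of_nonneg_of_le (fun n => tsum_nonneg fun _ => norm_nonneg _) fun n => ?_
  rw [tsum_fintype]
  refine le_of_eq_of_le ?_ (h n)
  exact Finset.sum_coe_sort (Finset.HasAntidiagonal.antidiagonal n) (fun p => ‖f p‖)

lemma tsum_prod_eq_tsum_antidiagonal {f : ℕ × ℕ → ℂ} (hf : Summable f) :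
    ∑' j, ∑' m, f (j, m) = ∑' n, ∑ p ∈ Finset.HasAntidiagonal.antidiagonal n, f p := by
  rw [← hf.tsum_prod, ← Finset.HasAntidiagonal.sigmaAntidiagonalEquivProd.tsum_eq]
  have hf' := (Finset.HasAntidiagonal.sigmaAntidiagonalEquivProd.summable_iff (f := f)).2 hf
  refine hf'.tsum_sigma.trans ?_
  refine tsum_congr fun n => ?_
  rw [tsum_fintype]
  exact Finset.sum_coe_sort (Finset.HasAntidiagonal.antidiagonal n) f

lemma watson_rearrangement {a b c d : ℂ} (hd : IsDenom d) (hc : 0 < c.re)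
    (h : 0 < (d + c - a - b).re) :
    Summable (fun j => symmMoment c j / j.factorial * ∑' m, halfTerm a b d j m) ∧
    ∑' n, gaussTerm a b d n * (poch c n / poch (2 * c) n) =
      ∑' j, symmMoment c j / j.factorial * ∑' m, halfTerm a b d j m := by
  set f : ℕ × ℕ → ℂ := fun p => symmMoment c p.1 / p.1.factorial * halfTerm a b d p.1 p.2 with hf
  have hfe : ∀ n, ∀ p ∈ Finset.HasAntidiagonal.antidiagonal n, f p =
      gaussTerm a b d n * (1 / 2) ^ n * (n.choose p.1 * symmMoment c p.1) := fun n p hp => by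
    have := Nat.cast_ne_zero (R := ℂ).2 p.1.factorial_ne_zero
    rw [hf, ← Finset.HasAntidiagonal.mem_antidiagonal.1 hp]
    simp only [halfTerm_eq]
    field_simp
  have hs : Summable f := by
    refine summable_of_summable_antidiagonal (summable_gaussTerm_mul_poch_div hd hc h) fun n => ?_
    have h1 := sum_choose_mul_norm_symmMoment_le hc n
    rw [Finset.sum_congr rfl fun p hp => by rw [hfe n p hp],
      Finset.Nat.sum_antidiagonal_eq_sum_range_succ_mk]
    simp only [norm_mul, norm_natCast, ← Finset.mul_sum]
    refine (mul_le_mul_of_nonneg_left h1 (by positivity)).trans (le_of_eq ?_)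
    rw [mul_assoc, ← mul_assoc (‖((1 : ℂ) / 2) ^ n‖)]
    simp
  have h2 := tsum_prod_eq_tsum_antidiagonal hs
  have h3 := hs.prod
  simp only [hf, tsum_mul_left] at h2 h3
  refine ⟨h3, ?_⟩
  rw [h2]
  refine tsum_congr fun n => ?_
  rw [Finset.sum_congr rfl (hfe n), Finset.Nat.sum_antidiagonal_eq_sum_range_succ_mk,
    ← Finset.mul_sum, sum_choose_mul_symmMoment (isDenom_two_mul hc), mul_assoc,
    ← mul_assoc ((1 / 2) ^ n), ← mul_pow]
  norm_num

lemma symmMoment_odd (c : ℂ) (k : ℕ) : symmMoment c (2 * k + 1) = 0 := by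
  induction k with
  | zero => simp [symmMoment]
  | succ k ih =>
    rw [show 2 * (k + 1) + 1 = (2 * k + 1) + 2 by ring, symmMoment, ih, mul_zero]

lemma watson_even_term {a b c d : ℂ} (hd : IsDenom d) (hc : 0 < c.re) (hab : 2 * d = a + b + 1)
    (k : ℕ) :
    symmMoment c (2 * k) / (2 * k).factorial * ∑' m, halfTerm a b d (2 * k) m =
      (∑' m, halfTerm a b d 0 m) * gaussTerm (a / 2) (b / 2) (c + 1 / 2) k := by
  have hc' : IsDenom (c + 1 / 2) := isDenom_of_re_pos (by simp; positivity)
  induction k with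
  | zero => simp [symmMoment, gaussTerm]
  | succ k ih =>
    have h1 := hc'.add_nat_ne_zero k
    have h3 : ((2 * k).factorial : ℂ) ≠ 0 := Nat.cast_ne_zero.2 (Nat.factorial_ne_zero _)
    have h4 : (k : ℂ) + 1 ≠ 0 := Nat.cast_add_one_ne_zero k
    have h5 : (2 * k : ℂ) + 1 ≠ 0 := by exact_mod_cast (2 * k).succ_ne_zero
    have hg := gaussTerm_ratio (a / 2) (b / 2) hc' k
    rw [show 2 * (k + 1) = 2 * k + 2 by ring, tsum_halfTerm_add_two hd hab, symmMoment,
      Nat.factorial_succ, Nat.factorial_succ]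
    refine mul_left_cancel₀ (mul_ne_zero h1 h4) ?_
    have hR : (c + 1 / 2 + k) * (k + 1) * ((∑' m, halfTerm a b d 0 m) *
        gaussTerm (a / 2) (b / 2) (c + 1 / 2) (k + 1)) = (a / 2 + k) * (b / 2 + k) *
        (symmMoment c (2 * k) / (2 * k).factorial * ∑' m, halfTerm a b d (2 * k) m) := by
      rw [ih]
      linear_combination (∑' m, halfTerm a b d 0 m) * hg
    rw [hR]
    push_cast
    rw [show 2 * c + 1 + 2 * (k : ℂ) = 2 * (c + 1 / 2 + k) by ring,
      show (2 * k : ℂ) + 1 + 1 = 2 * (k + 1) by ring]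
    generalize c + 1 / 2 + (k : ℂ) = x at h1 ⊢
    generalize 2 * (k : ℂ) + 1 = y at h5 ⊢
    generalize (k : ℂ) + 1 = z at h4 ⊢
    field_simp

lemma watson_aux {a b c d : ℂ} (hd : IsDenom d) (hc : 0 < c.re) (hab : 2 * d = a + b + 1)
    (h : 0 < (d + c - a - b).re) :
    ∑' n, gaussTerm a b d n * (poch c n / poch (2 * c) n) = (∑' m, halfTerm a b d 0 m) *
      (Gamma (c + 1 / 2) * Gamma (c + 1 / 2 - a / 2 - b / 2) /
        (Gamma (c + 1 / 2 - a / 2) * Gamma (c + 1 / 2 - b / 2))) := by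
  have hc' : IsDenom (c + 1 / 2) := isDenom_of_re_pos (by simp; positivity)
  have h' : 0 < (c + 1 / 2 - a / 2 - b / 2).re := by
    rwa [show c + 1 / 2 - a / 2 - b / 2 = d + c - a - b by linear_combination -hab / 2]
  rw [(watson_rearrangement hd hc h).2, ← tsum_gaussTerm hc' h', ← tsum_mul_left]
  have hinj : Function.Injective fun k : ℕ => 2 * k := fun x y hxy => by simpa using hxy
  rw [← hinj.tsum_eq]
  · exact tsum_congr fun k => watson_even_term hd hc hab k
  · intro j hj
    rcases Nat.even_or_odd' j with ⟨k, rfl | rfl⟩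
    · exact ⟨k, rfl⟩
    · simp [symmMoment_odd] at hj

lemma poch_zero_left {n : ℕ} (hn : n ≠ 0) : poch 0 n = 0 := by
  obtain ⟨m, rfl⟩ := Nat.exists_eq_succ_of_ne_zero hn
  rw [Nat.succ_eq_add_one, poch_succ_left, zero_mul]

lemma tsum_halfTerm_swap (a b d : ℂ) (j : ℕ) :
    ∑' m, halfTerm a b d j m = ∑' m, halfTerm b a d j m := by
  simp only [halfTerm, mul_comm (poch a _)]

lemma tsum_halfTerm_two {a b d : ℂ} (hd : IsDenom d) :
    ∑' m, halfTerm a b d 2 m = a * (a + 1) * b * (b + 1) / (4 * d * (d + 1)) *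
      ∑' m, halfTerm (a + 2) (b + 2) (d + 2) 0 m := by
  rw [← tsum_mul_left]
  refine tsum_congr fun m => ?_
  have h0 := hd.ne_zero
  have h1 := hd.add_one.ne_zero
  have h2 := hd.add_two.poch_ne_zero m
  have h3 : (m.factorial : ℂ) ≠ 0 := Nat.cast_ne_zero.2 m.factorial_ne_zero
  have hp : ∀ x : ℂ, poch x (2 + m) = x * (x + 1) * poch (x + 2) m := fun x => by
    rw [poch_add, poch_succ, poch_succ]
    simp
  simp only [halfTerm, hp, zero_add, pow_add]
  field_simp
  ring

lemma tsum_halfTerm_zero_of_zero {b d : ℂ} (hd : IsDenom d) (hab : 2 * d = b + 1) :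
    ∑' m, halfTerm 0 b d 0 m =
      Gamma (1 / 2) * Gamma d / (Gamma ((0 + 1) / 2) * Gamma ((b + 1) / 2)) := by
  rw [tsum_eq_single 0 fun m hm => by simp [halfTerm, poch_zero_left hm], ← hab, zero_add,
    mul_div_cancel_left₀ _ two_ne_zero, div_self]
  · simp [halfTerm]
  · exact mul_ne_zero (isDenom_of_re_pos (by simp)).Gamma_ne_zero hd.Gamma_ne_zero

lemma tsum_halfTerm_zero_of_re_pos {a b d : ℂ} (ha : 0 < a.re) (hb : 0 < b.re)
    (hab : 2 * d = a + b + 1) :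
    ∑' m, halfTerm a b d 0 m =
      Gamma (1 / 2) * Gamma d / (Gamma ((a + 1) / 2) * Gamma ((b + 1) / 2)) := by
  have hdre := congrArg re hab
  simp at hdre
  have hdpos : 0 < d.re := by linarith
  have hd : IsDenom d := isDenom_of_re_pos hdpos
  have h2d := isDenom_two_mul hdpos
  have h := watson_aux hd hdpos hab (by simp; linarith)
  have hl : ∑' n, gaussTerm a b d n * (poch d n / poch (2 * d) n) =
      ∑' n, gaussTerm a b (2 * d) n := tsum_congr fun n => by
    have := hd.poch_ne_zero n
    have := h2d.poch_ne_zero n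
    simp only [gaussTerm]
    field_simp
  rw [hl, tsum_gaussTerm h2d (by simp; linarith),
    show 2 * d - a - b = 1 by linear_combination hab, show 2 * d - a = b + 1 by linear_combination hab,
    show 2 * d - b = a + 1 by linear_combination hab,
    show d + 1 / 2 - a / 2 - b / 2 = 1 by linear_combination hab / 2,
    show d + 1 / 2 - a / 2 = (b + 1) / 2 + 1 / 2 by linear_combination hab / 2,
    show d + 1 / 2 - b / 2 = (a + 1) / 2 + 1 / 2 by linear_combination hab / 2] at h
  have dup := Complex.Gamma_mul_Gamma_add_half
  have dd := dup d
  have da := dup ((a + 1) / 2)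
  have db := dup ((b + 1) / 2)
  rw [mul_div_cancel₀ _ two_ne_zero] at da db
  have hpow : (2 : ℂ) ^ (1 - 2 * d) = 2 ^ (1 - (a + 1)) * 2 ^ (1 - (b + 1)) := by
    rw [← cpow_add _ _ two_ne_zero]
    congr 1
    linear_combination -hab
  have hpi : Gamma (1 / 2) = (√Real.pi : ℂ) := by
    have := dup (1 / 2)
    norm_num [Gamma_one] at this
    simpa using this
  rw [hpow] at dd
  rw [hpi]
  have hne : ∀ x : ℂ, 0 < x.re → Gamma x ≠ 0 := fun x hx => (isDenom_of_re_pos hx).Gamma_ne_zero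
  have n1 := hne ((a + 1) / 2) (by simp; linarith)
  have n2 := hne ((b + 1) / 2) (by simp; linarith)
  have n3 := hne ((a + 1) / 2 + 1 / 2) (by simp; linarith)
  have n4 := hne ((b + 1) / 2 + 1 / 2) (by simp; linarith)
  have n5 := hne (d + 1 / 2) (by simp; linarith)
  have n6 := hne (a + 1) (by simp; linarith)
  have n7 := hne (b + 1) (by simp; linarith)
  rw [Gamma_one, mul_one, mul_one] at h
  generalize ∑' m, halfTerm a b d 0 m = K at h ⊢
  have hK : K = Gamma (2 * d) * Gamma ((a + 1) / 2 + 1 / 2) * Gamma ((b + 1) / 2 + 1 / 2) /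
      (Gamma (a + 1) * Gamma (b + 1) * Gamma (d + 1 / 2)) := by
    rw [div_eq_iff (mul_ne_zero n7 n6)] at h
    rw [h]
    generalize Gamma ((a + 1) / 2 + 1 / 2) = x at n3 ⊢
    generalize Gamma ((b + 1) / 2 + 1 / 2) = y at n4 ⊢
    generalize Gamma (d + 1 / 2) = z at n5 ⊢
    field_simp
  rw [hK, div_eq_div_iff (by positivity) (by positivity)]
  calc _ = Gamma (2 * d) * (Gamma ((a + 1) / 2) * Gamma ((a + 1) / 2 + 1 / 2)) *
        (Gamma ((b + 1) / 2) * Gamma ((b + 1) / 2 + 1 / 2)) := by ring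
    _ = (√Real.pi : ℂ) * (Gamma d * Gamma (d + 1 / 2)) * Gamma (a + 1) * Gamma (b + 1) := by
      rw [da, db, dd]
      ring
    _ = _ := by ring

lemma tsum_halfTerm_zero {a b d : ℂ} (hd : IsDenom d) (hab : 2 * d = a + b + 1) :
    ∑' m, halfTerm a b d 0 m =
      Gamma (1 / 2) * Gamma d / (Gamma ((a + 1) / 2) * Gamma ((b + 1) / 2)) := by
  obtain ⟨N, hN⟩ := exists_nat_gt (max (-a.re) (-b.re))
  have hNa := (le_max_left _ _).trans_lt hN
  have hNb := (le_max_right _ _).trans_lt hN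
  clear hN
  induction N generalizing a b d with
  | zero =>
    simp at hNa hNb
    exact tsum_halfTerm_zero_of_re_pos hNa hNb hab
  | succ N ih =>
    rcases eq_or_ne a 0 with rfl | ha
    · exact tsum_halfTerm_zero_of_zero hd (by simpa using hab)
    rcases eq_or_ne b 0 with rfl | hb
    · rw [tsum_halfTerm_swap, tsum_halfTerm_zero_of_zero hd (by simpa using hab),
        mul_comm (Gamma ((0 + 1) / 2))]
    push_cast at hNa hNb
    have h := ih hd.add_two (a := a + 2) (b := b + 2) (by linear_combination hab)
      (by simp; linarith) (by simp; linarith)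
    have h2 := tsum_halfTerm_add_two hd hab 0
    rw [zero_add, tsum_halfTerm_two hd, h] at h2
    have h0 := hd.ne_zero
    have h1 := hd.add_one.ne_zero
    have hGd : Gamma (d + 2) = (d + 1) * (d * Gamma d) := by
      rw [show d + 2 = d + 1 + 1 by ring, Gamma_add_one _ h1, Gamma_add_one _ h0]
    have hG : ∀ x : ℂ, (x + 1) / Gamma ((x + 2 + 1) / 2) = 2 / Gamma ((x + 1) / 2) := fun x => by
      rcases eq_or_ne (x + 1) 0 with hx | hx
      · simp [hx]
      · rw [show (x + 2 + 1) / 2 = (x + 1) / 2 + 1 by ring,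
          Gamma_add_one _ (div_ne_zero hx two_ne_zero)]
        field_simp
    have ea := hG a
    have eb := hG b
    refine mul_left_cancel₀ (mul_ne_zero ha hb) ?_
    simp only [Nat.cast_zero, add_zero] at h2
    rw [← h2, hGd]
    calc _ = a * b / 4 * Gamma (1 / 2) * Gamma d * ((a + 1) / Gamma ((a + 2 + 1) / 2)) *
          ((b + 1) / Gamma ((b + 2 + 1) / 2)) := by field_simp
      _ = _ := by rw [ea, eb]; ring

/-- **Watson's theorem** for `₃F₂(a, b, c; (a + b + 1) / 2, 2 * c; 1)`. -/
theorem watson {a b c d : ℂ} (hd : IsDenom d) (hc : 0 < c.re) (hab : 2 * d = a + b + 1)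
    (h : 0 < (d + c - a - b).re) :
    ∑' n, gaussTerm a b d n * (poch c n / poch (2 * c) n) =
      Gamma (1 / 2) * Gamma d / (Gamma ((a + 1) / 2) * Gamma ((b + 1) / 2)) *
      (Gamma (c + 1 / 2) * Gamma (c + 1 / 2 - a / 2 - b / 2) /
        (Gamma (c + 1 / 2 - a / 2) * Gamma (c + 1 / 2 - b / 2))) := by
  rw [watson_aux hd hc hab h, tsum_halfTerm_zero hd hab]

/-! ### Entire power series of exponential type -/

/-- The coefficients `φ n` are bounded by `M ^ n / n!`. -/
def ExpBounded (φ : ℕ → ℂ) : Prop := ∃ M : ℝ, 0 ≤ M ∧ ∀ n, ‖φ n‖ ≤ M ^ n / n.factorial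

/-- The power series with coefficients `φ`. -/
noncomputable def powSeries (φ : ℕ → ℂ) (z : ℂ) : ℂ := ∑' n, φ n * z ^ n

lemma ExpBounded.summable_norm {φ : ℕ → ℂ} (h : ExpBounded φ) (z : ℂ) :
    Summable fun n => ‖φ n * z ^ n‖ := by
  obtain ⟨M, _, h⟩ := h
  refine (Real.summable_pow_div_factorial (M * ‖z‖)).of_nonneg_of_le (fun _ => norm_nonneg _)
    fun n => ?_
  rw [norm_mul, norm_pow, mul_pow, mul_div_right_comm]
  exact mul_le_mul_of_nonneg_right (h n) (by positivity)

lemma ExpBounded.summable {φ : ℕ → ℂ} (h : ExpBounded φ) (z : ℂ) :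
    Summable fun n => φ n * z ^ n := (h.summable_norm z).of_norm

lemma ExpBounded.hasDerivAt {φ : ℕ → ℂ} (h : ExpBounded φ) (z : ℂ) :
    HasDerivAt (powSeries φ) (powSeries (fun n => (n + 1) * φ (n + 1)) z) z := by
  obtain ⟨M, hM, hφ⟩ := id h
  set R := ‖z‖ + 1
  have hR : 0 ≤ R := by positivity
  set u : ℕ → ℝ := fun n => n * (M ^ n / n.factorial) * R ^ (n - 1) with hu
  have hsu : Summable u := by
    rw [← summable_nat_add_iff 1]
    refine ((Real.summable_pow_div_factorial (M * R)).mul_left M).congr fun n => ?_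
    have h4 : (n : ℝ) + 1 ≠ 0 := by positivity
    simp only [hu, Nat.factorial_succ, Nat.add_sub_cancel, mul_pow, pow_succ]
    push_cast
    field_simp
  have hbound : ∀ n, ∀ y ∈ Metric.ball (0 : ℂ) R, ‖φ n * (n * y ^ (n - 1))‖ ≤ u n := by
    intro n y hy
    rw [norm_mul, norm_mul, norm_natCast, norm_pow, mul_left_comm, ← mul_assoc]
    have := hφ n
    have := (mem_ball_zero_iff.1 hy).le
    simp only [hu]
    gcongr
  have hz : z ∈ Metric.ball (0 : ℂ) R := by simp [R]
  have key := hasDerivAt_tsum_of_isPreconnected (g := fun n y => φ n * y ^ n)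
    (g' := fun n y => φ n * (n * y ^ (n - 1))) hsu Metric.isOpen_ball
    (convex_ball (0 : ℂ) R).isPreconnected
    (fun n y _ => (hasDerivAt_pow n y).const_mul _) hbound hz (h.summable z) hz
  refine key.congr_deriv ?_
  have hs : Summable fun n => φ n * (n * z ^ (n - 1)) :=
    Summable.of_norm_bounded hsu fun n => hbound n z hz
  rw [hs.tsum_eq_zero_add]
  simp only [powSeries, Nat.cast_zero, zero_mul, mul_zero, zero_add, Nat.add_sub_cancel]
  exact tsum_congr fun n => by push_cast; ring

lemma ExpBounded.differentiable {φ : ℕ → ℂ} (h : ExpBounded φ) : Differentiable ℂ (powSeries φ) :=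
  fun z => (h.hasDerivAt z).differentiableAt

lemma exists_norm_poch_div_le (a : ℂ) {d : ℂ} (hd : IsDenom d) :
    ∃ M : ℝ, 0 ≤ M ∧ ∀ n, ‖poch a n / poch d n‖ ≤ M ^ n := by
  have ht : Tendsto (fun n : ℕ => (a + n) / (d + n)) atTop (𝓝 1) := by
    have h1 : ∀ x : ℂ, Tendsto (fun n : ℕ => x * (n : ℂ)⁻¹ + 1) atTop (𝓝 1) := fun x => by
      simpa using (tendsto_inv_atTop_nhds_zero_nat.const_mul x).add_const 1
    have h2 := (h1 a).div (h1 d) one_ne_zero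
    rw [div_one] at h2
    refine h2.congr' ?_
    filter_upwards [eventually_gt_atTop 0] with n hn
    have hn' : (n : ℂ) ≠ 0 := Nat.cast_ne_zero.2 hn.ne'
    have := hd.add_nat_ne_zero n
    simp only [Pi.div_apply]
    rw [← mul_div_mul_right _ _ hn']
    congr 1 <;> field_simp
  obtain ⟨M, hM⟩ := (Metric.isBounded_range_of_tendsto _ ht).exists_norm_le
  have hM' : ∀ n : ℕ, ‖(a + n) / (d + n)‖ ≤ M := fun n => hM _ (mem_range_self n)
  refine ⟨M, (norm_nonneg _).trans (hM' 0), fun n => ?_⟩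
  induction n with
  | zero => simp
  | succ n ih =>
    rw [poch_succ, poch_succ, mul_div_mul_comm, norm_mul, pow_succ]
    exact mul_le_mul ih (hM' n) (norm_nonneg _) ((norm_nonneg _).trans ih)

lemma ExpBounded.mul_poch_div {φ : ℕ → ℂ} (h : ExpBounded φ) (a : ℂ) {d : ℂ} (hd : IsDenom d) :
    ExpBounded fun n => φ n * (poch a n / poch d n) := by
  obtain ⟨M, hM, h⟩ := h
  obtain ⟨M', hM', h'⟩ := exists_norm_poch_div_le a hd
  refine ⟨M * M', by positivity, fun n => ?_⟩
  rw [norm_mul, mul_pow, mul_div_right_comm]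
  exact mul_le_mul (h n) (h' n) (norm_nonneg _) (by positivity)

lemma expBounded_inv_factorial : ExpBounded fun n => (n.factorial : ℂ)⁻¹ :=
  ⟨1, zero_le_one, fun n => by simp⟩

lemma powSeries_inv_factorial (z : ℂ) :
    powSeries (fun n => (n.factorial : ℂ)⁻¹) z = Complex.exp z := by
  rw [Complex.exp_eq_exp_ℂ, NormedSpace.exp_eq_tsum_div]
  exact tsum_congr fun n => by rw [div_eq_inv_mul]

/-! ### The series `₂F₂` -/

/-- The coefficients of `₂F₂(a, b; d, e; z)`. -/
noncomputable def hypCoeff (a b d e : ℂ) (n : ℕ) : ℂ :=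
  (n.factorial : ℂ)⁻¹ * (poch a n / poch d n) * (poch b n / poch e n)

lemma hyp_eq_powSeries (a b d e z : ℂ) : hyp [a, b] [d, e] z = powSeries (hypCoeff a b d e) z :=
  tsum_congr fun n => by
    simp only [hypCoeff, List.map_cons, List.map_nil, List.prod_cons, List.prod_nil]
    field_simp

lemma expBounded_hypCoeff (a b : ℂ) {d e : ℂ} (hd : IsDenom d) (he : IsDenom e) :
    ExpBounded (hypCoeff a b d e) :=
  (expBounded_inv_factorial.mul_poch_div a hd).mul_poch_div b he

lemma hypCoeff_swap (a b d e : ℂ) : hypCoeff a b d e = hypCoeff b a e d := by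
  funext n
  simp only [hypCoeff]
  ring

lemma hypCoeff_succ (a b : ℂ) {d e : ℂ} (hd : IsDenom d) (he : IsDenom e) (n : ℕ) :
    (n + 1) * hypCoeff a b d e (n + 1) =
      a * b / (d * e) * hypCoeff (a + 1) (b + 1) (d + 1) (e + 1) n := by
  have := hd.ne_zero
  have := he.ne_zero
  have := hd.add_one.poch_ne_zero n
  have := he.add_one.poch_ne_zero n
  have h4 : (n : ℂ) + 1 ≠ 0 := Nat.cast_add_one_ne_zero n
  have h5 : (n.factorial : ℂ) ≠ 0 := Nat.cast_ne_zero.2 n.factorial_ne_zero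
  simp only [hypCoeff, poch_succ_left, Nat.factorial_succ]
  push_cast
  field_simp

lemma hasDerivAt_powSeries_hypCoeff (a b : ℂ) {d e : ℂ} (hd : IsDenom d) (he : IsDenom e) (z : ℂ) :
    HasDerivAt (powSeries (hypCoeff a b d e))
      (a * b / (d * e) * powSeries (hypCoeff (a + 1) (b + 1) (d + 1) (e + 1)) z) z := by
  refine ((expBounded_hypCoeff a b hd he).hasDerivAt z).congr_deriv ?_
  rw [powSeries, powSeries, ← tsum_mul_left]
  exact tsum_congr fun n => by rw [hypCoeff_succ a b hd he, mul_assoc]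

lemma powSeries_hypCoeff_add_one (a b : ℂ) {d e : ℂ} (hd : IsDenom d) (he : IsDenom e) (z : ℂ) :
    powSeries (hypCoeff a b d e) z = powSeries (hypCoeff a b (d + 1) e) z +
      a * b / (d * (d + 1) * e) *
        (z * powSeries (hypCoeff (a + 1) (b + 1) (d + 2) (e + 1)) z) := by
  have s0 := (expBounded_hypCoeff a b hd he).summable z
  have s1 := (expBounded_hypCoeff a b hd.add_one he).summable z
  rw [← sub_eq_iff_eq_add', powSeries, powSeries, ← s0.tsum_sub s1, (s0.sub s1).tsum_eq_zero_add,
    powSeries, ← tsum_mul_left, ← tsum_mul_left]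
  simp only [hypCoeff, poch_zero, sub_self, zero_add]
  refine tsum_congr fun n => ?_
  have := hd.ne_zero
  have := he.ne_zero
  have := hd.add_one.ne_zero
  have h0 := hd.add_one.add_nat_ne_zero n
  have := hd.add_two.poch_ne_zero n
  have := he.add_one.poch_ne_zero n
  have h4 : (n : ℂ) + 1 ≠ 0 := Nat.cast_add_one_ne_zero n
  have h5 : (n.factorial : ℂ) ≠ 0 := Nat.cast_ne_zero.2 n.factorial_ne_zero
  have h6 : poch (d + 1) n * (d + 1 + n) = (d + 1) * poch (d + 2) n := by
    rw [← poch_succ, poch_succ_left, show d + 1 + 1 = d + 2 by ring]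
  have h7 : poch (d + 1) n = (d + 1) * poch (d + 2) n / (d + 1 + n) := by
    rw [← h6, mul_div_cancel_right₀ _ h0]
  rw [poch_succ_left d, poch_succ (d + 1), h7, poch_succ_left e, poch_succ_left a,
    poch_succ_left b, Nat.factorial_succ, pow_succ]
  push_cast
  generalize hx : d + 1 + (n : ℂ) = x at h0 ⊢
  have hx' : (n : ℂ) + 1 = x - d := by rw [← hx]; ring
  rw [hx'] at h4 ⊢
  field_simp

/-! ### Growth in sectors of the right half plane -/

/-- `f z = O(e ^ (re z) * |z| ^ (-p))` as `z → ∞`, uniformly in every closed sector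
`‖z‖ ≤ K * re z`. -/
def ExpDecay (f : ℂ → ℂ) (p : ℝ) : Prop :=
  ∀ K : ℝ, 0 < K → ∃ C : ℝ, 0 ≤ C ∧ ∀ z : ℂ, ‖z‖ ≤ K * z.re →
    ‖f z‖ ≤ C * (Real.exp z.re * (1 + ‖z‖) ^ (-p))

lemma exists_one_add_rpow_le (q : ℝ) {κ : ℝ} (hκ : 0 < κ) :
    ∃ C : ℝ, 0 ≤ C ∧ ∀ v : ℝ, 0 ≤ v → (1 + v) ^ q ≤ C * Real.exp (κ * v) := by
  obtain ⟨k, hk⟩ := exists_nat_gt q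
  refine ⟨k.factorial / κ ^ k * Real.exp κ, by positivity, fun v hv => ?_⟩
  have h1 : (1 + v) ^ q ≤ (1 + v) ^ k := by
    rw [← Real.rpow_natCast]
    exact Real.rpow_le_rpow_of_exponent_le (by linarith) hk.le
  have h2 := Real.pow_div_factorial_le_exp (κ * (1 + v)) (by positivity) k
  rw [div_le_iff₀ (by positivity), mul_pow] at h2
  refine h1.trans ?_
  rw [mul_assoc, ← Real.exp_add, div_mul_eq_mul_div, le_div_iff₀ (by positivity)]
  calc _ = κ ^ k * (1 + v) ^ k := mul_comm _ _
    _ ≤ _ := h2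
    _ = _ := by rw [mul_comm]; ring_nf

lemma one_add_mul_rpow_neg_le (p : ℝ) {A x : ℝ} (hA : 0 ≤ A) (hx : 0 ≤ x) (hx1 : x ≤ 1) :
    (1 + A * x) ^ (-p) ≤ (1 + A) ^ (-p) * (1 + A * (1 - x)) ^ |p| := by
  have hx2 : 0 ≤ 1 - x := by linarith
  rcases le_total 0 p with hp | hp
  · rw [abs_of_nonneg hp, Real.rpow_neg (by positivity), Real.rpow_neg (by positivity),
      ← div_eq_inv_mul, inv_eq_one_div, div_le_div_iff₀ (by positivity) (by positivity), one_mul,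
      ← Real.mul_rpow (by positivity) (by positivity)]
    refine Real.rpow_le_rpow (by positivity) ?_ hp
    have : 0 ≤ A * (1 - x) * (A * x) := by positivity
    nlinarith
  · refine (Real.rpow_le_rpow (by positivity) ?_ (neg_nonneg.2 hp)).trans
      (le_mul_of_one_le_right (by positivity) (Real.one_le_rpow ?_ (abs_nonneg p)))
    · have := mul_le_mul_of_nonneg_left hx1 hA
      linarith
    · have : 0 ≤ A * (1 - x) := by positivity
      linarith

lemma ExpDecay.mono {f : ℂ → ℂ} {p q : ℝ} (h : ExpDecay f p) (hqp : q ≤ p) : ExpDecay f q := by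
  intro K hK
  obtain ⟨C, hC, h⟩ := h K hK
  refine ⟨C, hC, fun z hz => (h z hz).trans ?_⟩
  gcongr
  have := norm_nonneg z
  linarith

lemma ExpDecay.add {f g : ℂ → ℂ} {p : ℝ} (hf : ExpDecay f p) (hg : ExpDecay g p) :
    ExpDecay (fun z => f z + g z) p := by
  intro K hK
  obtain ⟨C, hC, hf⟩ := hf K hK
  obtain ⟨C', hC', hg⟩ := hg K hK
  refine ⟨C + C', add_nonneg hC hC', fun z hz => (norm_add_le _ _).trans ?_⟩
  rw [add_mul]
  exact add_le_add (hf z hz) (hg z hz)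

lemma ExpDecay.const_mul {f : ℂ → ℂ} {p : ℝ} (hf : ExpDecay f p) (w : ℂ) :
    ExpDecay (fun z => w * f z) p := by
  intro K hK
  obtain ⟨C, hC, hf⟩ := hf K hK
  refine ⟨‖w‖ * C, by positivity, fun z hz => ?_⟩
  rw [norm_mul, mul_assoc]
  exact mul_le_mul_of_nonneg_left (hf z hz) (norm_nonneg w)

lemma ExpDecay.id_mul {f : ℂ → ℂ} {p : ℝ} (hf : ExpDecay f (p + 1)) :
    ExpDecay (fun z => z * f z) p := by
  intro K hK
  obtain ⟨C, hC, hf⟩ := hf K hK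
  refine ⟨C, hC, fun z hz => ?_⟩
  have h1 : 0 < 1 + ‖z‖ := by positivity
  have h2 : (1 + ‖z‖) ^ (-p) = (1 + ‖z‖) * (1 + ‖z‖) ^ (-(p + 1)) := by
    rw [show -p = 1 + -(p + 1) by ring, Real.rpow_add h1, Real.rpow_one]
  rw [norm_mul, h2]
  calc ‖z‖ * ‖f z‖ ≤ (1 + ‖z‖) * (C * (Real.exp z.re * (1 + ‖z‖) ^ (-(p + 1)))) := by
        gcongr
        · linarith
        · exact hf z hz
    _ = _ := by ring

lemma expDecay_exp : ExpDecay Complex.exp 0 := fun K hK =>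
  ⟨1, zero_le_one, fun z _ => by simp [Complex.norm_exp]⟩

lemma norm_div_le_re {K : ℝ} (hK : 0 < K) {z : ℂ} (hz : ‖z‖ ≤ K * z.re) : K⁻¹ * ‖z‖ ≤ z.re := by
  rwa [inv_mul_le_iff₀ hK]

/-- A bound for primitives, obtained by comparing along the segment from `0` to `z`. -/
lemma ExpDecay.of_hasDerivAt {F f : ℂ → ℂ} {p : ℝ} (hf : ExpDecay f p)
    (hF : ∀ z, HasDerivAt F (f z) z) : ExpDecay F p := by
  intro K hK
  obtain ⟨C, hC, hf⟩ := hf K hK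
  obtain ⟨D, hD, hp⟩ := exists_one_add_rpow_le p (κ := K⁻¹) (by positivity)
  obtain ⟨E, hE, hpa⟩ := exists_one_add_rpow_le |p| (κ := (2 * K)⁻¹) (by positivity)
  refine ⟨‖F 0‖ * D + C * E * (2 * K), by positivity, fun z hz => ?_⟩
  have hre := norm_div_le_re hK hz
  set W : ℝ := Real.exp z.re * (1 + ‖z‖) ^ (-p) with hW
  have hW0 : 0 ≤ W := by positivity
  set κ : ℝ := (2 * K)⁻¹ * ‖z‖ with hκ
  have h0 : ‖F 0‖ ≤ ‖F 0‖ * D * W := by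
    rw [mul_assoc]
    refine le_mul_of_one_le_right (norm_nonneg _) ?_
    have h1 := (hp ‖z‖ (norm_nonneg z)).trans
      (mul_le_mul_of_nonneg_left (Real.exp_le_exp.2 hre) hD)
    rwa [hW, Real.rpow_neg (by positivity), ← mul_assoc, ← div_eq_mul_inv,
      one_le_div (by positivity)]
  set B : ℝ → ℝ := fun t => ‖F 0‖ + C * E * (2 * K) * W * Real.exp (-(1 - t) * κ) with hB
  have hBd : ∀ t, HasDerivAt B (C * E * W * ‖z‖ * Real.exp (-(1 - t) * κ)) t := fun t => by
    have h1 : HasDerivAt (fun t : ℝ => -(1 - t) * κ) κ t := by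
      have := (((hasDerivAt_id t).const_sub 1).neg.mul_const κ)
      simpa using this
    refine ((h1.exp.const_mul _).const_add _).congr_deriv ?_
    rw [hκ]
    field_simp
  have hG : ∀ t : ℝ, HasDerivAt (fun t : ℝ => F (t * z)) (f (t * z) * z) t := fun t => by
    have h1 : HasDerivAt (fun t : ℝ => (t : ℂ) * z) z t := by
      simpa using (Complex.ofRealCLM.hasDerivAt (x := t)).mul_const z
    exact (hF _).comp t h1
  have key := image_norm_le_of_norm_deriv_right_le_deriv_boundary (a := 0) (b := 1)
    (f := fun t : ℝ => F (t * z)) (B := B)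
    (fun t _ => (hG t).continuousAt.continuousWithinAt) (fun t _ => (hG t).hasDerivWithinAt)
    (by simp [hB]; positivity) hBd (fun t ht => ?_) (right_mem_Icc.2 zero_le_one)
  · simp only [hB, ofReal_one, one_mul, sub_self, neg_zero, zero_mul, Real.exp_zero, mul_one] at key
    rw [add_mul]
    exact key.trans (by gcongr)
  · have ht0 : 0 ≤ t := ht.1
    have ht1 : t ≤ 1 := ht.2.le
    have ht2 : 0 ≤ 1 - t := by linarith
    have hn : ‖(t : ℂ) * z‖ = ‖z‖ * t := by
      rw [norm_mul, norm_real, Real.norm_of_nonneg ht0, mul_comm]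
    have hr : ((t : ℂ) * z).re = t * z.re := by simp
    have h1 := hf (t * z) (by rw [hn, hr]; nlinarith)
    rw [hn, hr] at h1
    have h2 := one_add_mul_rpow_neg_le p (norm_nonneg z) ht0 ht1
    have h3 := hpa (‖z‖ * (1 - t)) (by positivity)
    have h4 : Real.exp (t * z.re) ≤ Real.exp z.re * Real.exp (-(1 - t) * (2 * κ)) := by
      rw [← Real.exp_add, Real.exp_le_exp]
      have h5 : 2 * κ ≤ z.re := by
        rw [hκ, mul_inv]
        linarith
      nlinarith
    rw [norm_mul]
    calc ‖f (t * z)‖ * ‖z‖ ≤ C * ((Real.exp z.re * Real.exp (-(1 - t) * (2 * κ))) *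
          ((1 + ‖z‖) ^ (-p) * (E * Real.exp ((2 * K)⁻¹ * (‖z‖ * (1 - t)))))) * ‖z‖ := by
          gcongr
          refine h1.trans ?_
          gcongr
          exact h2.trans (by gcongr)
      _ = C * E * W * ‖z‖ * (Real.exp (-(1 - t) * (2 * κ)) *
          Real.exp ((2 * K)⁻¹ * (‖z‖ * (1 - t)))) := by
        rw [hW]
        ring
      _ = _ := by
        rw [← Real.exp_add, hκ]
        congr 2
        ring

/-! ### Beta averages of power series -/

/-- The integrand of the beta integral. -/
noncomputable def betaWeight (u v : ℂ) (x : ℝ) : ℂ := (x : ℂ) ^ (u - 1) * (1 - (x : ℂ)) ^ (v - 1)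

lemma integrableOn_betaWeight {u v : ℂ} (hu : 0 < u.re) (hv : 0 < v.re) :
    IntegrableOn (betaWeight u v) (Ioo 0 1) := by
  rw [← integrableOn_Ioc_iff_integrableOn_Ioo,
    ← intervalIntegrable_iff_integrableOn_Ioc_of_le zero_le_one]
  exact betaIntegral_convergent hu hv

lemma integral_betaWeight (u v : ℂ) : ∫ x in Ioo 0 1, betaWeight u v x = betaIntegral u v := by
  rw [betaIntegral, intervalIntegral.integral_of_le zero_le_one, integral_Ioc_eq_integral_Ioo]
  rfl

lemma betaWeight_mul_pow (u v : ℂ) (n : ℕ) {x : ℝ} (hx : 0 < x) :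
    betaWeight u v x * (x : ℂ) ^ n = betaWeight (u + n) v x := by
  have hx' : (x : ℂ) ≠ 0 := ofReal_ne_zero.2 hx.ne'
  rw [betaWeight, betaWeight, show u + n - 1 = u - 1 + n by ring, cpow_add _ _ hx', cpow_natCast]
  ring

lemma norm_betaWeight (u v : ℂ) {x : ℝ} (hx : x ∈ Ioo (0 : ℝ) 1) :
    ‖betaWeight u v x‖ = x ^ (u.re - 1) * (1 - x) ^ (v.re - 1) := by
  have h1 : (1 : ℂ) - x = ((1 - x : ℝ) : ℂ) := by push_cast; rfl
  rw [betaWeight, norm_mul, h1, norm_cpow_eq_rpow_re_of_pos hx.1,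
    norm_cpow_eq_rpow_re_of_pos (sub_pos.2 hx.2)]
  simp

lemma betaIntegral_add_nat {a d : ℂ} (ha : 0 < a.re) (hd : 0 < (d - a).re) (n : ℕ) :
    betaIntegral (a + n) (d - a) = poch a n / poch d n * betaIntegral a (d - a) := by
  have hd' : IsDenom d := isDenom_of_re_pos (by rw [sub_re] at hd; linarith)
  have h1 := Gamma_mul_Gamma_eq_betaIntegral ha hd
  have h2 := Gamma_mul_Gamma_eq_betaIntegral (s := a + n) (by simp; positivity) hd
  rw [add_sub_cancel] at h1
  rw [show a + n + (d - a) = d + n by ring, Gamma_add_nat_eq_poch hd',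
    Gamma_add_nat_eq_poch (isDenom_of_re_pos ha), mul_assoc, h1] at h2
  have h3 := hd'.Gamma_ne_zero
  have h4 := hd'.poch_ne_zero n
  field_simp
  refine mul_left_cancel₀ h3 ?_
  linear_combination -h2

lemma hasSum_beta_average {φ : ℕ → ℂ} (hφ : ExpBounded φ) {a d : ℂ} (ha : 0 < a.re)
    (hd : 0 < (d - a).re) (z : ℂ) :
    betaIntegral a (d - a) * powSeries (fun n => φ n * (poch a n / poch d n)) z =
      ∫ x in Ioo (0 : ℝ) 1, betaWeight a (d - a) x * powSeries φ (x * z) := by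
  have hw : ∀ n : ℕ, IntegrableOn (betaWeight (a + n) (d - a)) (Ioo 0 1) := fun n =>
    integrableOn_betaWeight (by simp; positivity) hd
  have hw0 := integrableOn_betaWeight ha hd
  have key := hasSum_integral_of_summable_integral_norm (μ := volume.restrict (Ioo (0 : ℝ) 1))
    (F := fun n x => φ n * z ^ n * betaWeight (a + n) (d - a) x)
    (fun n => (hw n).const_mul _) ?_
  · have h1 : ∫ x in Ioo (0 : ℝ) 1, betaWeight a (d - a) x * powSeries φ (x * z) =
        ∫ x in Ioo (0 : ℝ) 1, ∑' n, φ n * z ^ n * betaWeight (a + n) (d - a) x := by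
      refine setIntegral_congr_fun measurableSet_Ioo fun x hx => ?_
      simp only [powSeries, ← tsum_mul_left]
      refine tsum_congr fun n => ?_
      rw [← betaWeight_mul_pow _ _ _ hx.1, mul_pow]
      ring
    rw [h1, ← key.tsum_eq, powSeries, ← tsum_mul_left]
    refine tsum_congr fun n => ?_
    rw [integral_const_mul, integral_betaWeight, betaIntegral_add_nat ha hd]
    ring
  · refine ((hφ.summable_norm z).mul_right
      (∫ x in Ioo (0 : ℝ) 1, ‖betaWeight a (d - a) x‖)).of_nonneg_of_le
      (fun n => by positivity) fun n => ?_
    simp only [norm_mul, integral_const_mul]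
    refine mul_le_mul_of_nonneg_left ?_ (by positivity)
    refine setIntegral_mono_on (hw n).norm hw0.norm measurableSet_Ioo fun x hx => ?_
    rw [← betaWeight_mul_pow _ _ _ hx.1, norm_mul, norm_pow, norm_real,
      Real.norm_of_nonneg hx.1.le]
    exact mul_le_of_le_one_right (norm_nonneg _) (pow_le_one₀ hx.1.le hx.2.le)

lemma betaIntegral_ne_zero {u v : ℂ} (hu : 0 < u.re) (hv : 0 < v.re) : betaIntegral u v ≠ 0 := by
  have h := Gamma_mul_Gamma_eq_betaIntegral hu hv
  refine right_ne_zero_of_mul (a := Gamma (u + v)) ?_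
  rw [← h]
  exact mul_ne_zero (isDenom_of_re_pos hu).Gamma_ne_zero (isDenom_of_re_pos hv).Gamma_ne_zero

lemma ExpDecay.beta_average {φ : ℕ → ℂ} (hφ : ExpBounded φ) {p q : ℝ}
    (h : ExpDecay (powSeries φ) p) {a d : ℂ} (ha : 0 < a.re) (hq : 0 ≤ q)
    (hqd : q < (d - a).re) :
    ExpDecay (powSeries fun n => φ n * (poch a n / poch d n)) (p + q) := by
  have hd : 0 < (d - a).re := hq.trans_lt hqd
  intro K hK
  obtain ⟨C, hC, h⟩ := h K hK
  obtain ⟨D, hD, hp⟩ := exists_one_add_rpow_le (|p| + q) (κ := K⁻¹) (by positivity)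
  have hB := norm_pos_iff.2 (betaIntegral_ne_zero ha hd)
  have hw : IntegrableOn (betaWeight a (d - a - q)) (Ioo 0 1) :=
    integrableOn_betaWeight ha (by simpa using hqd)
  set J := ∫ x in Ioo (0 : ℝ) 1, ‖betaWeight a (d - a - q) x‖ with hJ
  have hJ0 : 0 ≤ J := by positivity
  refine ⟨‖betaIntegral a (d - a)‖⁻¹ * (C * D * J), by positivity, fun z hz => ?_⟩
  have hre := norm_div_le_re hK hz
  rw [mul_assoc, ← div_eq_inv_mul, le_div_iff₀ hB, mul_comm, ← norm_mul,
    hasSum_beta_average hφ ha hd]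
  set W : ℝ := Real.exp z.re * (1 + ‖z‖) ^ (-(p + q)) with hW
  rw [show C * D * J * W = ∫ x in Ioo (0 : ℝ) 1, C * D * W * ‖betaWeight a (d - a - q) x‖ by
    rw [integral_const_mul]; ring]
  refine norm_integral_le_of_norm_le (hw.norm.const_mul _) ?_
  refine (ae_restrict_iff' measurableSet_Ioo).2 (Eventually.of_forall fun x hx => ?_)
  have hx1 : 0 < 1 - x := sub_pos.2 hx.2
  have hn : ‖(x : ℂ) * z‖ = ‖z‖ * x := by
    rw [norm_mul, norm_real, Real.norm_of_nonneg hx.1.le, mul_comm]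
  have hr : ((x : ℂ) * z).re = x * z.re := by simp
  have h1 := h (x * z) (by rw [hn, hr]; nlinarith [hx.1])
  rw [hn, hr] at h1
  have h2 := one_add_mul_rpow_neg_le p (norm_nonneg z) hx.1.le hx.2.le
  have hv : 0 ≤ ‖z‖ * (1 - x) := by positivity
  have h3 := hp (‖z‖ * (1 - x)) hv
  have h4 : Real.exp (x * z.re) ≤ Real.exp z.re * Real.exp (-(K⁻¹ * (‖z‖ * (1 - x)))) := by
    rw [← Real.exp_add, Real.exp_le_exp]
    nlinarith
  -- the factor gained from the decay away from `x = 1`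
  have h5 : (1 + ‖z‖ * (1 - x)) ^ |p| ≤
      D * Real.exp (K⁻¹ * (‖z‖ * (1 - x))) * ((1 + ‖z‖) ^ (-q) * (1 - x) ^ (-q)) := by
    rw [show |p| = (|p| + q) + -q by ring, Real.rpow_add (by positivity)]
    refine mul_le_mul h3 ?_ (by positivity) (by positivity)
    rw [← Real.mul_rpow (by positivity) hx1.le]
    refine Real.rpow_le_rpow_of_nonpos (by positivity) ?_ (by linarith)
    nlinarith [hx.1]
  rw [norm_mul, norm_betaWeight _ _ hx, norm_betaWeight _ _ hx]
  have h6 : (1 - x) ^ ((d - a - q).re - 1) = (1 - x) ^ ((d - a).re - 1) * (1 - x) ^ (-q) := by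
    rw [← Real.rpow_add hx1]
    congr 1
    simp
    ring
  have h7 : (1 + ‖z‖) ^ (-(p + q)) = (1 + ‖z‖) ^ (-p) * (1 + ‖z‖) ^ (-q) := by
    rw [← Real.rpow_add (by positivity)]
    congr 1
    ring
  have h8 : Real.exp (-(K⁻¹ * (‖z‖ * (1 - x)))) * Real.exp (K⁻¹ * (‖z‖ * (1 - x))) = 1 := by
    rw [← Real.exp_add, neg_add_cancel, Real.exp_zero]
  have hx0 := hx.1
  calc _ ≤ x ^ (a.re - 1) * (1 - x) ^ ((d - a).re - 1) *
        (C * ((Real.exp z.re * Real.exp (-(K⁻¹ * (‖z‖ * (1 - x))))) * ((1 + ‖z‖) ^ (-p) *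
          (D * Real.exp (K⁻¹ * (‖z‖ * (1 - x))) * ((1 + ‖z‖) ^ (-q) * (1 - x) ^ (-q)))))) := by
        refine mul_le_mul_of_nonneg_left (h1.trans ?_) (by positivity)
        gcongr
        exact h2.trans (by gcongr)
    _ = C * D * (Real.exp z.re * ((1 + ‖z‖) ^ (-p) * (1 + ‖z‖) ^ (-q))) * (x ^ (a.re - 1) *
        ((1 - x) ^ ((d - a).re - 1) * (1 - x) ^ (-q))) *
        (Real.exp (-(K⁻¹ * (‖z‖ * (1 - x)))) * Real.exp (K⁻¹ * (‖z‖ * (1 - x)))) := by ring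
    _ = _ := by rw [h8, mul_one, h6, hW, h7]

/-! ### The growth of `₂F₂` -/

lemma expDecay_hypCoeff_of_re_pos {a b d e : ℂ} (ha : 0 < a.re) (hb : 0 < b.re)
    (hda : 0 < (d - a).re) (heb : 0 < (e - b).re) {p : ℝ} (hp : p < (d + e - a - b).re) :
    ExpDecay (powSeries (hypCoeff a b d e)) p := by
  have hd : IsDenom d := isDenom_of_re_pos (by rw [sub_re] at hda; linarith)
  simp only [sub_re, add_re] at hp hda heb
  obtain ⟨ε, hε, h1, h2, h3⟩ : ∃ ε : ℝ, 0 < ε ∧ ε ≤ d.re - a.re ∧ ε ≤ e.re - b.re ∧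
      p ≤ (d.re - a.re - ε) + (e.re - b.re - ε) := by
    refine ⟨min (min (d.re - a.re) (e.re - b.re)) ((d.re + e.re - a.re - b.re - p) / 2),
      lt_min (lt_min hda heb) (by linarith), (min_le_left _ _).trans (min_le_left _ _),
      (min_le_left _ _).trans (min_le_right _ _), ?_⟩
    have := min_le_right (min (d.re - a.re) (e.re - b.re)) ((d.re + e.re - a.re - b.re - p) / 2)
    linarith
  have h0 : ExpDecay (powSeries fun n => (n.factorial : ℂ)⁻¹) 0 := by
    simpa only [funext powSeries_inv_factorial] using expDecay_exp
  have ha' := h0.beta_average expBounded_inv_factorial ha (q := d.re - a.re - ε) (d := d)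
    (by linarith) (by simp [hε])
  have hb' := ha'.beta_average (expBounded_inv_factorial.mul_poch_div a hd) hb
    (q := e.re - b.re - ε) (d := e) (by linarith) (by simp [hε])
  exact hb'.mono (by linarith)

lemma expDecay_hypCoeff_raise {a b d e : ℂ} (hd : IsDenom d) (he : IsDenom e)
    (h1 : ∀ p < ((d + 1) + e - a - b).re, ExpDecay (powSeries (hypCoeff a b (d + 1) e)) p)
    (h2 : ∀ p < ((d + 2) + (e + 1) - (a + 1) - (b + 1)).re,
      ExpDecay (powSeries (hypCoeff (a + 1) (b + 1) (d + 2) (e + 1))) p) :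
    ∀ p < (d + e - a - b).re, ExpDecay (powSeries (hypCoeff a b d e)) p := by
  intro p hp
  have h3 := (h1 p (by simp at hp ⊢; linarith)).add
    ((h2 (p + 1) (by simp at hp ⊢; linarith)).id_mul.const_mul (a * b / (d * (d + 1) * e)))
  rwa [funext (powSeries_hypCoeff_add_one a b hd he)]

lemma expDecay_hypCoeff_of_re_pos_of_re_pos {a b d e : ℂ} (ha : 0 < a.re) (hb : 0 < b.re)
    (hd : IsDenom d) (he : IsDenom e) (heb : 0 < (e - b).re) :
    ∀ p < (d + e - a - b).re, ExpDecay (powSeries (hypCoeff a b d e)) p := by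
  obtain ⟨N, hN⟩ := exists_nat_gt (-(d - a).re)
  induction N generalizing a b d e with
  | zero => exact fun p => expDecay_hypCoeff_of_re_pos ha hb (by simpa using hN) heb
  | succ N ih =>
    push_cast at hN
    refine expDecay_hypCoeff_raise hd he ?_ ?_
    · exact ih ha hb hd.add_one he heb (by simp at hN ⊢; linarith)
    · exact ih (by simp; linarith) (by simp; linarith) hd.add_two he.add_one (by simpa using heb)
        (by simp at hN ⊢; linarith)

lemma expDecay_hypCoeff_of_num_re_pos {a b d e : ℂ} (ha : 0 < a.re) (hb : 0 < b.re)
    (hd : IsDenom d) (he : IsDenom e) :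
    ∀ p < (d + e - a - b).re, ExpDecay (powSeries (hypCoeff a b d e)) p := by
  obtain ⟨N, hN⟩ := exists_nat_gt (-(e - b).re)
  induction N generalizing a b d e with
  | zero => exact expDecay_hypCoeff_of_re_pos_of_re_pos ha hb hd he (by simpa using hN)
  | succ N ih =>
    push_cast at hN
    have h1 := ih ha hb hd he.add_one (by simp at hN ⊢; linarith)
    have h2 := ih (a := a + 1) (b := b + 1) (by simp; linarith) (by simp; linarith) hd.add_one
      he.add_two (by simp at hN ⊢; linarith)
    rw [hypCoeff_swap] at h1 h2 ⊢
    intro p hp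
    refine expDecay_hypCoeff_raise he hd (fun p hp => h1 p ?_) (fun p hp => h2 p ?_) p ?_ <;>
    · simp at hp ⊢
      linarith

/-- For all parameters, `₂F₂(a, b; d, e; z) = O(e ^ z * z ^ (-p))` for every
`p < re (d + e - a - b)`. -/
lemma expDecay_hypCoeff (a b : ℂ) {d e : ℂ} (hd : IsDenom d) (he : IsDenom e) :
    ∀ p < (d + e - a - b).re, ExpDecay (powSeries (hypCoeff a b d e)) p := by
  obtain ⟨N, hN⟩ := exists_nat_gt (max (-a.re) (-b.re))
  have hNa := (le_max_left _ _).trans_lt hN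
  have hNb := (le_max_right _ _).trans_lt hN
  clear hN
  induction N generalizing a b d e with
  | zero => exact expDecay_hypCoeff_of_num_re_pos (by simpa using hNa) (by simpa using hNb) hd he
  | succ N ih =>
    push_cast at hNa hNb
    intro p hp
    refine ExpDecay.of_hasDerivAt ?_ (hasDerivAt_powSeries_hypCoeff a b hd he)
    refine (ih (a + 1) (b + 1) hd.add_one he.add_one ?_ ?_ p ?_).const_mul _
    · simp; linarith
    · simp; linarith
    · simp at hp ⊢
      linarith

/-! ### Rotating the ray of integration -/

lemma integrableOn_rpow_mul_one_add_rpow {σ p l : ℝ} (hσ : 0 < σ) (hp : σ < p) (hl : 0 < l) :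
    IntegrableOn (fun t : ℝ => t ^ (σ - 1) * (1 + l * t) ^ (-p)) (Ioi 0) := by
  have hm : Measurable fun t : ℝ => t ^ (σ - 1) * (1 + l * t) ^ (-p) := by fun_prop
  rw [← Ioc_union_Ioi_eq_Ioi zero_le_one, integrableOn_union]
  constructor
  · have h := (intervalIntegral.intervalIntegrable_rpow' (a := 0) (b := 1)
      (show -1 < σ - 1 by linarith)).1
    refine Integrable.mono' h hm.aestronglyMeasurable ?_
    filter_upwards [ae_restrict_mem measurableSet_Ioc] with t ht
    have ht0 := ht.1
    rw [Real.norm_of_nonneg (by positivity)]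
    refine mul_le_of_le_one_right (by positivity)
      (Real.rpow_le_one_of_one_le_of_nonpos ?_ (by linarith))
    have : 0 ≤ l * t := by positivity
    linarith
  · have h := (integrableOn_Ioi_rpow_of_lt (show σ - 1 - p < -1 by linarith)
      zero_lt_one).const_mul (l ^ (-p))
    refine Integrable.mono' h hm.aestronglyMeasurable ?_
    filter_upwards [ae_restrict_mem measurableSet_Ioi] with t ht
    have ht0 : 0 < t := zero_lt_one.trans ht
    rw [Real.norm_of_nonneg (by positivity), sub_eq_add_neg (σ - 1), Real.rpow_add ht0,
      mul_left_comm, ← Real.mul_rpow hl.le ht0.le]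
    gcongr ?_ * ?_
    exact Real.rpow_le_rpow_of_nonpos (by positivity) (by linarith) (by linarith)

/-- `H z = O(|z| ^ (-p))` as `z → ∞`, uniformly in every closed sector `‖z‖ ≤ K * re z`. -/
def SectorDecay (H : ℂ → ℂ) (p : ℝ) : Prop :=
  ∀ K : ℝ, 0 < K → ∃ C : ℝ, 0 ≤ C ∧ ∀ z : ℂ, ‖z‖ ≤ K * z.re → ‖H z‖ ≤ C * (1 + ‖z‖) ^ (-p)

lemma ExpDecay.sectorDecay {f : ℂ → ℂ} {p : ℝ} (hf : ExpDecay f p) :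
    SectorDecay (fun z => Complex.exp (-z) * f z) p := by
  intro K hK
  obtain ⟨C, hC, h⟩ := hf K hK
  refine ⟨C, hC, fun z hz => ?_⟩
  rw [norm_mul, norm_exp, neg_re]
  calc _ ≤ Real.exp (-z.re) * (C * (Real.exp z.re * (1 + ‖z‖) ^ (-p))) := by gcongr; exact h z hz
    _ = C * (1 + ‖z‖) ^ (-p) * (Real.exp (-z.re) * Real.exp z.re) := by ring
    _ = _ := by rw [← Real.exp_add, neg_add_cancel, Real.exp_zero, mul_one]

lemma SectorDecay.exists_norm_comp_mul_le {H : ℂ → ℂ} {p : ℝ} (hH : SectorDecay H p) (hp : 0 ≤ p)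
    {l : ℝ} (hl : 0 < l) (B : ℝ) :
    ∃ C : ℝ, 0 ≤ C ∧ ∀ w : ℂ, l ≤ w.re → ‖w‖ ≤ B → ∀ t : ℝ, 0 < t →
      ‖H (w * t)‖ ≤ C * (1 + l * t) ^ (-p) := by
  obtain ⟨C, hC, h⟩ := hH (max B l / l) (div_pos (lt_max_of_lt_right hl) hl)
  refine ⟨C, hC, fun w hw hwB t ht => (h _ ?_).trans ?_⟩
  · rw [norm_mul, norm_real, Real.norm_of_nonneg ht.le, re_mul_ofReal, ← mul_assoc]
    gcongr
    calc ‖w‖ ≤ max B l / l * l := by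
          rw [div_mul_cancel₀ _ hl.ne']; exact hwB.trans (le_max_left _ _)
      _ ≤ _ := by gcongr
  · gcongr C * ?_
    refine Real.rpow_le_rpow_of_nonpos (by positivity) ?_ (by linarith)
    rw [norm_mul, norm_real, Real.norm_of_nonneg ht.le]
    gcongr
    exact hw.trans (re_le_norm w)

lemma SectorDecay.differentiableAt_integral {H : ℂ → ℂ} {p : ℝ} (hH : SectorDecay H p)
    (hd : Differentiable ℂ H) {c : ℂ} (hc : 0 < c.re) (hcp : c.re < p) {s : ℂ} (hs : 0 < s.re) :
    DifferentiableAt ℂ (fun s : ℂ => ∫ t in Ioi (0 : ℝ), (t : ℂ) ^ (c - 1) * H (s * t)) s := by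
  set δ := s.re / 4 with hδ
  have hδ0 : 0 < δ := by positivity
  obtain ⟨C, hC, hb⟩ := hH.exists_norm_comp_mul_le (hc.trans hcp).le (half_pos hs) (‖s‖ + 2 * δ)
  have hb' : ∀ w : ℂ, ‖w - s‖ ≤ 2 * δ → ∀ t : ℝ, 0 < t →
      ‖H (w * t)‖ ≤ C * (1 + s.re / 2 * t) ^ (-p) := by
    intro w hw
    refine hb w ?_ ?_
    · have h1 := (abs_le.1 ((abs_re_le_norm (w - s)).trans hw)).1
      rw [sub_re] at h1
      linarith
    · have := norm_le_norm_add_norm_sub' w s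
      linarith
  have hint := integrableOn_rpow_mul_one_add_rpow hc hcp (half_pos hs)
  have hcpow : ∀ t : ℝ, 0 < t → ‖(t : ℂ) ^ (c - 1)‖ = t ^ (c.re - 1) := fun t ht => by
    rw [norm_cpow_eq_rpow_re_of_pos ht, sub_re, one_re]
  have hmeas : ∀ {G : ℂ → ℂ}, Continuous G → ∀ w : ℂ,
      AEStronglyMeasurable (fun t : ℝ => (t : ℂ) ^ (c - 1) * G (w * t))
        (volume.restrict (Ioi 0)) := fun hG w =>
    ((measurable_ofReal.pow_const _).mul
      (hG.comp (continuous_const.mul continuous_ofReal)).measurable).aestronglyMeasurable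
  have hd' : Continuous (deriv H) := hd.contDiff.continuous_deriv le_rfl
  have hdt : ∀ (t : ℝ) (w : ℂ), HasDerivAt (fun w => H (w * t)) (deriv H (w * t) * t) w :=
    fun t w => (hd (w * t)).hasDerivAt.comp w (hasDerivAt_mul_const (t : ℂ))
  refine (hasDerivAt_integral_of_dominated_loc_of_deriv_le
    (F' := fun w t => (t : ℂ) ^ (c - 1) * (deriv H (w * t) * t))
    (bound := fun t => C / δ * (t ^ (c.re - 1) * (1 + s.re / 2 * t) ^ (-p)))
    (Metric.ball_mem_nhds s hδ0) (Eventually.of_forall fun w => hmeas hd.continuous w) ?_ ?_ ?_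
    (hint.const_mul _) ?_).2.differentiableAt
  · refine Integrable.mono' (hint.const_mul C) (hmeas hd.continuous s) ?_
    filter_upwards [ae_restrict_mem measurableSet_Ioi] with t ht
    rw [norm_mul, hcpow t ht, mul_left_comm]
    have := Real.rpow_nonneg (le_of_lt (show 0 < t from ht)) (c.re - 1)
    gcongr
    exact hb' s (by simp; positivity) t ht
  · exact ((measurable_ofReal.pow_const _).mul
      ((hd'.comp (continuous_const.mul continuous_ofReal)).mul
        continuous_ofReal).measurable).aestronglyMeasurable
  · filter_upwards [ae_restrict_mem measurableSet_Ioi] with t ht w hw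
    rw [norm_mul, hcpow t ht, ← (hdt t w).deriv, div_mul_eq_mul_div, mul_left_comm,
      mul_div_assoc]
    have := Real.rpow_nonneg (le_of_lt (show 0 < t from ht)) (c.re - 1)
    gcongr
    refine norm_deriv_le_of_forall_mem_sphere_norm_le hδ0
      (Differentiable.diffContOnCl fun w => (hdt t w).differentiableAt) fun z hz => hb' z ?_ t ht
    rw [mem_ball_iff_norm] at hw
    rw [mem_sphere_iff_norm] at hz
    have := norm_sub_le_norm_sub_add_norm_sub z w s
    linarith
  · filter_upwards with t w _
    exact (hdt t w).const_mul _

lemma SectorDecay.integral_cpow_mul_comp_mul {H : ℂ → ℂ} {p : ℝ} (hH : SectorDecay H p)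
    (hd : Differentiable ℂ H) {c : ℂ} (hc : 0 < c.re) (hcp : c.re < p) {s : ℂ} (hs : 0 < s.re) :
    ∫ t in Ioi (0 : ℝ), (t : ℂ) ^ (c - 1) * H (s * t) =
      s ^ (-c) * ∫ t in Ioi (0 : ℝ), (t : ℂ) ^ (c - 1) * H t := by
  set U : Set ℂ := {z | 0 < z.re}
  have hU : IsOpen U := isOpen_lt continuous_const continuous_re
  have h1 : AnalyticOnNhd ℂ (fun s : ℂ => ∫ t in Ioi (0 : ℝ), (t : ℂ) ^ (c - 1) * H (s * t)) U :=
    DifferentiableOn.analyticOnNhd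
      (fun z hz => (hH.differentiableAt_integral hd hc hcp hz).differentiableWithinAt) hU
  have h2 : AnalyticOnNhd ℂ
      (fun s : ℂ => s ^ (-c) * ∫ t in Ioi (0 : ℝ), (t : ℂ) ^ (c - 1) * H t) U :=
    DifferentiableOn.analyticOnNhd (fun z hz => ((differentiableAt_id.cpow_const
      (Or.inl hz)).mul_const _).differentiableWithinAt) hU
  have hreal : ∀ r : ℝ, 0 < r → ∫ t in Ioi (0 : ℝ), (t : ℂ) ^ (c - 1) * H (r * t) =
      (r : ℂ) ^ (-c) * ∫ t in Ioi (0 : ℝ), (t : ℂ) ^ (c - 1) * H t := by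
    intro r hr
    have hr' : (r : ℂ) ≠ 0 := ofReal_ne_zero.2 hr.ne'
    have h := integral_comp_mul_left_Ioi (fun x : ℝ => (x : ℂ) ^ (c - 1) * H x) 0 hr
    rw [mul_zero, real_smul] at h
    have h3 : ∫ x in Ioi (0 : ℝ), ((r * x : ℝ) : ℂ) ^ (c - 1) * H ((r * x : ℝ) : ℂ) =
        (r : ℂ) ^ (c - 1) * ∫ t in Ioi (0 : ℝ), (t : ℂ) ^ (c - 1) * H (r * t) := by
      rw [← integral_const_mul]
      refine setIntegral_congr_fun measurableSet_Ioi fun x hx => ?_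
      simp only [ofReal_mul, mul_cpow_ofReal_nonneg hr.le (le_of_lt hx), mul_assoc]
    rw [h3] at h
    have h4 : (r : ℂ) ^ (-c) = ((r : ℂ) ^ (c - 1))⁻¹ * (r : ℂ)⁻¹ := by
      rw [← cpow_neg, ← cpow_neg_one, ← cpow_add _ _ hr']
      ring_nf
    have h5 : (r : ℂ) ^ (c - 1) ≠ 0 := by simp [cpow_eq_zero_iff, hr']
    rw [h4, mul_assoc, ← ofReal_inv, ← h, inv_mul_cancel_left₀ h5]
  refine h1.eqOn_of_preconnected_of_frequently_eq h2
    (convex_halfSpace_re_gt 0).isPreconnected (show (1 : ℂ) ∈ U by simp [U]) ?_ hs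
  have ht : Tendsto (fun r : ℝ => (r : ℂ)) (𝓝[>] 1) (𝓝[≠] 1) := by
    refine tendsto_nhdsWithin_iff.2 ⟨?_, ?_⟩
    · exact (continuous_ofReal.tendsto' 1 1 ofReal_one).mono_left nhdsWithin_le_nhds
    · filter_upwards [self_mem_nhdsWithin] with r hr
      simpa using (ne_of_gt hr)
  refine ht.frequently (Eventually.frequently ?_)
  filter_upwards [self_mem_nhdsWithin] with r hr
  exact hreal r (zero_lt_one.trans hr)

/-! ### Termwise integration -/

lemma hypCoeff_eq_gaussTerm (a b d e : ℂ) (n : ℕ) :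
    hypCoeff a b d e n = gaussTerm a b d n / poch e n := by
  simp only [hypCoeff, gaussTerm]
  field_simp

lemma integral_powSeries_mul_exp {a b c d : ℂ} (hd : IsDenom d) (hc : 0 < c.re)
    (h : 0 < (d + c - a - b).re) :
    ∫ t in Ioi (0 : ℝ), (t : ℂ) ^ (c - 1) *
        (Complex.exp (-t) * powSeries (hypCoeff a b d (2 * c)) t) =
      Gamma c * ∑' n, gaussTerm a b d n * (poch c n / poch (2 * c) n) := by
  set φ := hypCoeff a b d (2 * c)
  have h2 := isDenom_two_mul hc
  set F : ℕ → ℝ → ℂ := fun n t => φ n * (Complex.exp (-t) * (t : ℂ) ^ (c + n - 1)) with hF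
  have hcn : ∀ n : ℕ, 0 < (c + n).re := fun n => by
    simp only [add_re, natCast_re]; positivity
  have hpow : ∀ (n : ℕ) {t : ℝ}, 0 < t → (t : ℂ) ^ (c + n - 1) = (t : ℂ) ^ (c - 1) * t ^ n := by
    intro n t ht
    rw [add_sub_right_comm, cpow_add _ _ (ofReal_ne_zero.2 ht.ne'), cpow_natCast]
  have hint : ∀ n, Integrable (F n) (volume.restrict (Ioi 0)) := fun n =>
    ((GammaIntegral_convergent (hcn n)).congr_fun (fun t _ => by simp) measurableSet_Ioi).const_mul _
  have hval : ∀ n, ∫ t in Ioi (0 : ℝ), F n t =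
      Gamma c * (gaussTerm a b d n * (poch c n / poch (2 * c) n)) := by
    intro n
    have := Gamma_eq_integral (hcn n)
    rw [GammaIntegral] at this
    simp only [hF, integral_const_mul]
    simp only [ofReal_exp, ofReal_neg] at this
    rw [← this, Gamma_add_nat_eq_poch (isDenom_of_re_pos hc)]
    simp only [φ, hypCoeff_eq_gaussTerm]
    ring
  have hnorm : ∀ n, ∫ t in Ioi (0 : ℝ), ‖F n t‖ =
      ‖φ n‖ * (‖poch (c.re : ℂ) n‖ * ‖Gamma (c.re : ℂ)‖) := by
    intro n
    have hre : 0 < c.re + n := by positivity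
    rw [← norm_mul, ← Gamma_add_nat_eq_poch (isDenom_of_re_pos (by simpa using hc)),
      ← ofReal_natCast, ← ofReal_add, Gamma_ofReal, norm_real,
      Real.norm_of_nonneg (Real.Gamma_pos_of_pos hre).le, Real.Gamma_eq_integral hre,
      ← integral_const_mul]
    refine setIntegral_congr_fun measurableSet_Ioi fun t ht => ?_
    simp only [hF, norm_mul, norm_exp, norm_cpow_eq_rpow_re_of_pos (show 0 < t from ht)]
    simp
  have hsum : Summable fun n => ∫ t in Ioi (0 : ℝ), ‖F n t‖ := by
    refine ((summable_gaussTerm_mul_poch_div hd hc h).mul_right ‖Gamma (c.re : ℂ)‖).of_nonneg_of_le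
      (fun n => integral_nonneg fun _ => norm_nonneg _) fun n => ?_
    rw [hnorm, ← mul_assoc]
    have h3 : 0 < ((2 * (c.re : ℂ))).re := by simpa using hc
    have h4 := norm_poch_re_le (c := 2 * c) (by simpa using hc) n
    have h5 := norm_pos_iff.2 ((isDenom_of_re_pos h3).poch_ne_zero n)
    simp only [φ, hypCoeff_eq_gaussTerm, norm_div]
    rw [div_mul_eq_mul_div, ← mul_div_assoc]
    gcongr
    simpa using h4
  rw [← tsum_mul_left, ← tsum_congr hval,
    ← (hasSum_integral_of_summable_integral_norm hint hsum).tsum_eq.symm]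
  refine setIntegral_congr_fun measurableSet_Ioi fun t ht => ?_
  simp only [hF, powSeries]
  rw [← tsum_mul_left, ← tsum_mul_left]
  exact tsum_congr fun n => by rw [hpow n ht]; ring

theorem stmt6 (a b c s : ℂ) (hc : 0 < c.re) (hs : 0 < s.re)
    (hab : -1 < (2 * c - a - b).re)
    (hd₁ : (∀ n : ℕ, (a + b + 1) / 2 ≠ -(n : ℂ))) (hd₂ : (∀ n : ℕ, 2 * c ≠ -(n : ℂ))) :
    ∫ t in Ioi (0:ℝ), Complex.exp (-(s * t)) * (t : ℂ) ^ (c - 1) *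
        hyp [a, b] [(a + b + 1) / 2, 2 * c] (s * t)
      = s ^ (-c) * Complex.Gamma (1/2) * Complex.Gamma c * Complex.Gamma (c + 1/2) * Complex.Gamma ((a + b + 1) / 2) *
          Complex.Gamma (c - (a + b) / 2 + 1/2) /
          (Complex.Gamma ((a + 1) / 2) * Complex.Gamma ((b + 1) / 2) * Complex.Gamma (c - a / 2 + 1/2) *
            Complex.Gamma (c - b / 2 + 1/2)) := by
  set d := (a + b + 1) / 2 with hd
  have h2d : 2 * d = a + b + 1 := by rw [hd]; ring
  have hpos : 0 < (d + c - a - b).re := by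
    have h1 : d + c - a - b = ((1 / 2 : ℝ) : ℂ) * (2 * c - a - b + 1) := by
      rw [hd]; push_cast; ring
    rw [h1, re_ofReal_mul, add_re, one_re]
    linarith
  have hp : c.re < (d + 2 * c - a - b).re := by
    have h1 : d + 2 * c - a - b = d + c - a - b + c := by ring
    rw [h1, add_re]
    linarith
  obtain ⟨p, hcp, hp⟩ := exists_between hp
  have hdecay := (expDecay_hypCoeff a b hd₁ hd₂ p hp).sectorDecay
  have hdiff : Differentiable ℂ fun z => Complex.exp (-z) * powSeries (hypCoeff a b d (2 * c)) z :=
    differentiable_neg.cexp.mul (expBounded_hypCoeff a b hd₁ hd₂).differentiable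
  have hmain := hdecay.integral_cpow_mul_comp_mul hdiff hc hcp hs
  rw [integral_powSeries_mul_exp hd₁ hc hpos, watson hd₁ hc h2d hpos] at hmain
  calc _ = _ := integral_congr_ae (Eventually.of_forall fun t => by
        simp only [hyp_eq_powSeries]; ring)
    _ = _ := hmain
    _ = _ := by
      rw [show c - (a + b) / 2 + 1 / 2 = c + 1 / 2 - a / 2 - b / 2 by ring,
        show c - a / 2 + 1 / 2 = c + 1 / 2 - a / 2 by ring,
        show c - b / 2 + 1 / 2 = c + 1 / 2 - b / 2 by ring]
      simp only [div_eq_mul_inv, mul_inv]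
      ring
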